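/- arXiv:1410.6269 — 3 statements merged into one kernel-verified Lean document; each statement's English description precedes it below -/
import Mathlib

section
/- Let ℓ > 1 and let f be a Cherry map of exponent ℓ with flat arc U. Then the set ⋃_{n=0}^∞ f^{−n}(U) has full Lebesgue (Haar) measure in ℝ/ℤ. -/
open Filter

noncomputable section

/-- The Gauss map `x ↦ {1/x}`. -/
def gaussMap (x : ℝ) : ℝ := Int.fract (1 / x)

/-- The `n`-th partial quotient (`n ≥ 1`) of the continued fraction expansion
`ρ = [0; a_1, a_2, …]` of an irrational `ρ ∈ (0,1)`. -/
def cfA (ρ : ℝ) (n : ℕ) : ℕ := ⌊1 / (gaussMap^[n - 1] ρ)⌋₊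

/-- The denominators of the convergents of `ρ`: `q_0 = 1`, `q_1 = a_1`,
`q_{n+2} = a_{n+2} q_{n+1} + q_n`. -/
def cfQ (ρ : ℝ) : ℕ → ℕ
  | 0 => 1
  | 1 => cfA ρ 1
  | n + 2 => cfA ρ (n + 2) * cfQ ρ (n + 1) + cfQ ρ n

/-- `ρ` is of bounded type if its partial quotients are bounded. -/
def BoundedType (ρ : ℝ) : Prop := ∃ M : ℕ, ∀ i ≥ 1, cfA ρ i ≤ M

/-- A Cherry map of exponent `ℓ > 1`: a continuous degree-one monotone circle map with a
flat open arc `U = (a,b)`, a `C^∞` diffeomorphism off the closure of `U`, behaving like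
`x ↦ x^ℓ` in one-sided `C^∞` local coordinates at the endpoints of `U`, and with no
periodic points (hence irrational rotation number `rho`). -/
structure CherryMap (ℓ : ℝ) where
  /-- the circle map -/
  f : AddCircle (1 : ℝ) → AddCircle (1 : ℝ)
  /-- a lift of `f` to the real line -/
  F : ℝ → ℝ
  cont : Continuous f
  isLift : ∀ x : ℝ, f (x : AddCircle (1 : ℝ)) = ((F x : ℝ) : AddCircle (1 : ℝ))
  mono : Monotone F
  degree_one : ∀ x : ℝ, F (x + 1) = F x + 1
  /-- left endpoint of the flat arc -/
  a : ℝ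
  /-- right endpoint of the flat arc -/
  b : ℝ
  hab : a < b
  hba : b < a + 1
  /-- `f` is constant on the closure of `U = (a,b)` -/
  flat : ∀ x ∈ Set.Icc a b, F x = F a
  /-- `f` is `C^∞` off the closure of `U` -/
  smooth : ContDiffOn ℝ (⊤ : ℕ∞) F (Set.Ioo b (a + 1))
  /-- `f` is a diffeomorphism onto its image off the closure of `U` -/
  deriv_pos : ∀ x ∈ Set.Ioo b (a + 1), 0 < deriv F x
  /-- radius of the one-sided coordinate neighbourhoods at `a` and `b` -/
  ε : ℝ
  εpos : 0 < ε
  /-- `C^∞` local coordinate at `a` -/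
  ψa : ℝ → ℝ
  /-- `C^∞` local coordinate at `b` -/
  ψb : ℝ → ℝ
  ψa_smooth : ContDiff ℝ (⊤ : ℕ∞) ψa
  ψb_smooth : ContDiff ℝ (⊤ : ℕ∞) ψb
  ψa_zero : ψa 0 = 0
  ψb_zero : ψb 0 = 0
  ψa_deriv_pos : 0 < deriv ψa 0
  ψb_deriv_pos : 0 < deriv ψb 0
  /-- near `b`, `f` is `x ↦ x^ℓ` in the local coordinate -/
  local_b : ∀ t ∈ Set.Ico (0 : ℝ) ε, F (b + t) = F b + ψb (t ^ ℓ)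
  /-- near `a`, `f` is `x ↦ x^ℓ` in the local coordinate -/
  local_a : ∀ t ∈ Set.Ico (0 : ℝ) ε, F (a - t) = F a - ψa (t ^ ℓ)
  /-- `f` has no periodic points -/
  no_periodic_pt : ∀ (x : AddCircle (1 : ℝ)) (n : ℕ), 1 ≤ n → f^[n] x ≠ x
  /-- the rotation number of `f` -/
  rho : ℝ
  rho_mem : rho ∈ Set.Ioo (0 : ℝ) 1
  rho_irrational : Irrational rho
  rho_lim : ∃ m : ℤ, ∀ x : ℝ,
    Tendsto (fun n : ℕ => F^[n] x / n) atTop (nhds (rho + m))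

namespace CherryMap

variable {ℓ : ℝ}

/-- The flat arc `U = (a,b)` of a Cherry map, as a subset of the circle. -/
def U (X : CherryMap ℓ) : Set (AddCircle (1 : ℝ)) :=
  (fun t : ℝ => (t : AddCircle (1 : ℝ))) '' Set.Ioo X.a X.b

/-- The constant value `c = f(a)` of a Cherry map on the closure of its flat arc. -/
def c (X : CherryMap ℓ) : AddCircle (1 : ℝ) := X.f ((X.a : ℝ) : AddCircle (1 : ℝ))

end CherryMap

end

/-- A monotone-comparison with a Möbius map. -/
theorem mul_sub_le_of_deriv_ge_mobius {F F' : ℝ → ℝ} {x y c α β : ℝ} (hxy : x < y)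
    (hF : ContinuousOn F (Set.Icc x y)) (hF' : ∀ t ∈ Set.Ioo x y, HasDerivAt F (F' t) t)
    (hpos : ∀ t ∈ Set.Icc x y, 0 < α + β * t)
    (hle : ∀ t ∈ Set.Ioo x y, c / (α + β * t) ^ 2 ≤ F' t) :
    c * (y - x) ≤ (F y - F x) * ((α + β * x) * (α + β * y)) := by
  have hx := hpos x ⟨le_rfl, hxy.le⟩
  have hy := hpos y ⟨hxy.le, le_rfl⟩
  have hm : MonotoneOn (fun t => F t - c * ((t - x) / ((α + β * x) * (α + β * t))))
      (Set.Icc x y) := by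
    have hd : ∀ t ∈ Set.Ioo x y, HasDerivAt
        (fun t => F t - c * ((t - x) / ((α + β * x) * (α + β * t))))
        (F' t - c / (α + β * t) ^ 2) t := by
      intro t ht
      have hp := hpos t ⟨ht.1.le, ht.2.le⟩
      have h1 : HasDerivAt (fun t => t - x) 1 t := (hasDerivAt_id t).sub_const x
      have h2 : HasDerivAt (fun t => (α + β * x) * (α + β * t)) ((α + β * x) * (β * 1)) t :=
        (((hasDerivAt_id t).const_mul β).const_add α).const_mul _
      have h3 := (hF' t ht).sub ((h1.div h2 (by positivity)).const_mul c)
      refine h3.congr_deriv ?_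
      field_simp
      ring
    apply monotoneOn_of_deriv_nonneg (convex_Icc x y)
    · apply hF.sub
      apply ContinuousOn.mul continuousOn_const
      apply ContinuousOn.div (by fun_prop) (by fun_prop)
      intro t ht
      have := hpos t ht
      positivity
    · rw [interior_Icc]
      exact fun t ht => (hd t ht).differentiableAt.differentiableWithinAt
    · rw [interior_Icc]
      intro t ht
      rw [(hd t ht).deriv]
      linarith [hle t ht]
  have := hm ⟨le_rfl, hxy.le⟩ ⟨hxy.le, le_rfl⟩ hxy.le
  simp only [sub_self, zero_div, mul_zero, sub_zero] at this
  have h4 : c * ((y - x) / ((α + β * x) * (α + β * y))) ≤ F y - F x := by linarith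
  rw [← mul_div_assoc, div_le_iff₀ (by positivity)] at h4
  exact h4

theorem sub_mul_le_of_deriv_le_mobius {F F' : ℝ → ℝ} {x y c α β : ℝ} (hxy : x < y)
    (hF : ContinuousOn F (Set.Icc x y)) (hF' : ∀ t ∈ Set.Ioo x y, HasDerivAt F (F' t) t)
    (hpos : ∀ t ∈ Set.Icc x y, 0 < α + β * t)
    (hle : ∀ t ∈ Set.Ioo x y, F' t ≤ c / (α + β * t) ^ 2) :
    (F y - F x) * ((α + β * x) * (α + β * y)) ≤ c * (y - x) := by
  have := mul_sub_le_of_deriv_ge_mobius (F := fun t => -F t) (F' := fun t => -F' t) (c := -c)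
    hxy hF.neg (fun t ht => (hF' t ht).neg) hpos
    (fun t ht => by rw [neg_div]; exact neg_le_neg (hle t ht))
  linarith

/-- Cross-ratio expansion, up to a factor controlled by the oscillation of `g`, of a map with
derivative `exp g / v ^ 2`, where `v` is positive and convex. -/
theorem cross_ratio_le_of_deriv_eq {F g v : ℝ → ℝ} {p q x₁ x₂ x₃ x₄ ω : ℝ}
    (hF : ContinuousOn F (Set.Icc p q))
    (hF' : ∀ t ∈ Set.Ioo p q, HasDerivAt F (Real.exp (g t) / v t ^ 2) t)
    (hv : ConvexOn ℝ (Set.Ioo p q) v) (hv0 : ∀ t ∈ Set.Ioo p q, 0 < v t)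
    (hmono : StrictMonoOn F (Set.Icc p q))
    (h1 : p ≤ x₁) (h12 : x₁ < x₂) (h23 : x₂ < x₃) (h34 : x₃ < x₄) (h4 : x₄ ≤ q)
    (hg : ∀ t ∈ Set.Ioo x₁ x₄, |g t - g x₂| ≤ ω) :
    (x₃ - x₂) * (x₄ - x₁) * ((F x₂ - F x₁) * (F x₄ - F x₃)) ≤
      Real.exp (4 * ω) * ((F x₃ - F x₂) * (F x₄ - F x₁) * ((x₂ - x₁) * (x₄ - x₃))) := by
  have m2 : x₂ ∈ Set.Ioo p q := ⟨by linarith, by linarith⟩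
  have m3 : x₃ ∈ Set.Ioo p q := ⟨by linarith, by linarith⟩
  have v2 := hv0 _ m2
  have v3 := hv0 _ m3
  obtain ⟨β, hβ⟩ : ∃ β, β * (x₃ - x₂) = v x₃ - v x₂ :=
    ⟨(v x₃ - v x₂) / (x₃ - x₂), div_mul_cancel₀ _ (by linarith)⟩
  obtain ⟨α, hα⟩ : ∃ α, α + β * x₂ = v x₂ := ⟨v x₂ - β * x₂, by ring⟩
  have hα3 : α + β * x₃ = v x₃ := by linarith
  have hω : 0 ≤ ω := (abs_nonneg _).trans (hg x₂ ⟨h12, by linarith⟩)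
  have hgu : ∀ t ∈ Set.Ioo x₁ x₄, Real.exp (g t) ≤ Real.exp (g x₂ + ω) := fun t ht =>
    Real.exp_le_exp.2 (by linarith [(abs_le.1 (hg t ht)).2])
  have hgl : ∀ t ∈ Set.Ioo x₁ x₄, Real.exp (g x₂ - ω) ≤ Real.exp (g t) := fun t ht =>
    Real.exp_le_exp.2 (by linarith [(abs_le.1 (hg t ht)).1])
  -- position of `v` with respect to its chord
  have hin : ∀ t ∈ Set.Ioo x₂ x₃, v t ≤ α + β * t := by
    intro t ht
    have := hv.slope_mono_adjacent m2 m3 ht.1 ht.2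
    rw [div_le_div_iff₀ (by linarith [ht.1]) (by linarith [ht.2])] at this
    have : v t * (x₃ - x₂) ≤ (α + β * t) * (x₃ - x₂) := by
      have e1 : v t - v x₂ = v t - (α + β * x₂) := by rw [hα]
      have e2 : v x₃ - v t = (α + β * x₃) - v t := by rw [hα3]
      rw [e1, e2] at this
      nlinarith
    exact le_of_mul_le_mul_right this (by linarith)
  have hleft : ∀ t ∈ Set.Ioo p x₂, α + β * t ≤ v t := by
    intro t ht
    have := hv.slope_mono_adjacent (⟨ht.1, ht.2.trans m2.2⟩ : t ∈ Set.Ioo p q) m3 ht.2 h23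
    rw [← hβ, mul_div_cancel_right₀ _ (by linarith), div_le_iff₀ (by linarith [ht.2])] at this
    linarith
  have hright : ∀ t ∈ Set.Ioo x₃ q, α + β * t ≤ v t := by
    intro t ht
    have := hv.slope_mono_adjacent m2 (⟨m3.1.trans ht.1, ht.2⟩ : t ∈ Set.Ioo p q) h23 ht.1
    rw [← hβ, mul_div_cancel_right₀ _ (by linarith), le_div_iff₀ (by linarith [ht.1])] at this
    linarith
  have dmid : Real.exp (g x₂ - ω) * (x₃ - x₂) ≤ (F x₃ - F x₂) * (v x₂ * v x₃) := by
    have := mul_sub_le_of_deriv_ge_mobius (F := F) (F' := fun t => Real.exp (g t) / v t ^ 2)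
      (c := Real.exp (g x₂ - ω)) (α := α) (β := β) h23
      (hF.mono (Set.Icc_subset_Icc m2.1.le m3.2.le))
      (fun t ht => hF' t ⟨m2.1.trans ht.1, ht.2.trans m3.2⟩) ?_ ?_
    · rwa [hα, hα3] at this
    · intro t ht
      rcases eq_or_lt_of_le ht.1 with rfl | h
      · rw [hα]; exact v2
      rcases eq_or_lt_of_le ht.2 with rfl | h'
      · rw [hα3]; exact v3
      exact (hv0 t ⟨m2.1.trans h, h'.trans m3.2⟩).trans_le (hin t ⟨h, h'⟩)
    · intro t ht
      have := hv0 t ⟨m2.1.trans ht.1, ht.2.trans m3.2⟩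
      have := hin t ht
      have := hgl t ⟨h12.trans ht.1, ht.2.trans h34⟩
      gcongr
  have dl : (F x₂ - F x₁) * ((α + β * x₁) * v x₂) ≤ Real.exp (g x₂ + ω) * (x₂ - x₁) := by
    have hF12 : F x₁ < F x₂ := hmono ⟨h1, by linarith⟩ ⟨m2.1.le, m2.2.le⟩ h12
    rcases le_or_gt (α + β * x₁) 0 with hneg | hpos
    · have : (α + β * x₁) * v x₂ ≤ 0 := mul_nonpos_of_nonpos_of_nonneg hneg v2.le
      have : (F x₂ - F x₁) * ((α + β * x₁) * v x₂) ≤ 0 :=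
        mul_nonpos_of_nonneg_of_nonpos (by linarith) this
      have : 0 ≤ Real.exp (g x₂ + ω) * (x₂ - x₁) :=
        mul_nonneg (Real.exp_pos _).le (by linarith)
      linarith
    · have hp : ∀ t ∈ Set.Icc x₁ x₂, 0 < α + β * t := by
        intro t ht
        rw [← hα] at v2
        by_contra! hc
        nlinarith [ht.1, ht.2]
      have := sub_mul_le_of_deriv_le_mobius (F := F) (F' := fun t => Real.exp (g t) / v t ^ 2)
        (c := Real.exp (g x₂ + ω)) (α := α) (β := β) h12
        (hF.mono (Set.Icc_subset_Icc h1 m2.2.le))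
        (fun t ht => hF' t ⟨h1.trans_lt ht.1, ht.2.trans m2.2⟩) hp ?_
      · rwa [hα] at this
      · intro t ht
        have := hp t ⟨ht.1.le, ht.2.le⟩
        have := hleft t ⟨h1.trans_lt ht.1, ht.2⟩
        have := hgu t ⟨ht.1, by linarith [ht.2]⟩
        gcongr
  have dr : (F x₄ - F x₃) * (v x₃ * (α + β * x₄)) ≤ Real.exp (g x₂ + ω) * (x₄ - x₃) := by
    have hF34 : F x₃ < F x₄ := hmono ⟨m3.1.le, m3.2.le⟩ ⟨by linarith, h4⟩ h34
    rcases le_or_gt (α + β * x₄) 0 with hneg | hpos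
    · have : v x₃ * (α + β * x₄) ≤ 0 := mul_nonpos_of_nonneg_of_nonpos v3.le hneg
      have : (F x₄ - F x₃) * (v x₃ * (α + β * x₄)) ≤ 0 :=
        mul_nonpos_of_nonneg_of_nonpos (by linarith) this
      have : 0 ≤ Real.exp (g x₂ + ω) * (x₄ - x₃) :=
        mul_nonneg (Real.exp_pos _).le (by linarith)
      linarith
    · have hp : ∀ t ∈ Set.Icc x₃ x₄, 0 < α + β * t := by
        intro t ht
        rw [← hα3] at v3
        by_contra! hc
        nlinarith [ht.1, ht.2]
      have := sub_mul_le_of_deriv_le_mobius (F := F) (F' := fun t => Real.exp (g t) / v t ^ 2)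
        (c := Real.exp (g x₂ + ω)) (α := α) (β := β) h34
        (hF.mono (Set.Icc_subset_Icc m3.1.le h4))
        (fun t ht => hF' t ⟨m3.1.trans ht.1, ht.2.trans_le h4⟩) hp ?_
      · rwa [hα3] at this
      · intro t ht
        have := hp t ⟨ht.1.le, ht.2.le⟩
        have := hright t ⟨ht.1, ht.2.trans_le h4⟩
        have := hgu t ⟨by linarith [ht.1], ht.2⟩
        gcongr
  have f12 : 0 < F x₂ - F x₁ := sub_pos.2 (hmono ⟨h1, by linarith⟩ ⟨m2.1.le, m2.2.le⟩ h12)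
  have f23 : 0 < F x₃ - F x₂ := sub_pos.2 (hmono ⟨m2.1.le, m2.2.le⟩ ⟨m3.1.le, m3.2.le⟩ h23)
  have f34 : 0 < F x₄ - F x₃ := sub_pos.2 (hmono ⟨m3.1.le, m3.2.le⟩ ⟨by linarith, h4⟩ h34)
  -- eliminate the common constant
  have hQ : Real.exp (g x₂ + ω) = Real.exp (2 * ω) * Real.exp (g x₂ - ω) := by
    rw [← Real.exp_add]; ring_nf
  have hE := Real.exp_pos (g x₂ - ω)
  have hQ1 : 1 ≤ Real.exp (2 * ω) := Real.one_le_exp (by linarith)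
  have hQ4 : Real.exp (4 * ω) = Real.exp (2 * ω) ^ 2 := by
    rw [← Real.exp_nat_mul]; ring_nf
  rw [hQ] at dl dr
  rw [hQ4]
  generalize Real.exp (2 * ω) = Q at *
  generalize Real.exp (g x₂ - ω) = E at *
  have e14 : F x₄ - F x₁ = (F x₂ - F x₁) + (F x₃ - F x₂) + (F x₄ - F x₃) := by ring
  have x14 : x₄ - x₁ = (x₂ - x₁) + (x₃ - x₂) + (x₄ - x₃) := by ring
  have eα1 : α + β * x₁ = v x₂ - β * (x₂ - x₁) := by linarith
  have eα4 : α + β * x₄ = v x₃ + β * (x₄ - x₃) := by linarith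
  rw [e14, x14]
  rw [eα1] at dl
  rw [eα4] at dr
  have l0 : 0 < x₂ - x₁ := by linarith
  have j0 : 0 < x₃ - x₂ := by linarith
  have r0 : 0 < x₄ - x₃ := by linarith
  generalize x₂ - x₁ = L0 at *
  generalize x₃ - x₂ = J0 at *
  generalize x₄ - x₃ = R0 at *
  generalize F x₂ - F x₁ = L at *
  generalize F x₃ - F x₂ = J at *
  generalize F x₄ - F x₃ = R at *
  generalize v x₂ = V2 at *
  generalize v x₃ = V3 at *
  have hA : L * V2 * (J0 + L0) ≤ L0 * V3 * (Q * J + L) := by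
    have h5 : (L * ((V2 - β * L0) * V2)) * J0 ≤ Q * L0 * (J * (V2 * V3)) :=
      calc (L * ((V2 - β * L0) * V2)) * J0 ≤ (Q * E * L0) * J0 := by gcongr
        _ = Q * L0 * (E * J0) := by ring
        _ ≤ _ := by gcongr
    have h6 : V2 * (L * V2 * (J0 + L0)) ≤ V2 * (L0 * V3 * (Q * J + L)) := by
      have : (L * ((V2 - β * L0) * V2)) * J0 = L * V2 * (V2 * J0 - L0 * (V3 - V2)) := by
        rw [← hβ]; ring
      rw [this] at h5
      linarith
    exact le_of_mul_le_mul_left h6 v2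
  have hB : R * V3 * (J0 + R0) ≤ R0 * V2 * (Q * J + R) := by
    have h5 : (R * (V3 * (V3 + β * R0))) * J0 ≤ Q * R0 * (J * (V2 * V3)) :=
      calc (R * (V3 * (V3 + β * R0))) * J0 ≤ (Q * E * R0) * J0 := by gcongr
        _ = Q * R0 * (E * J0) := by ring
        _ ≤ _ := by gcongr
    have h6 : V3 * (R * V3 * (J0 + R0)) ≤ V3 * (R0 * V2 * (Q * J + R)) := by
      have : (R * (V3 * (V3 + β * R0))) * J0 = R * V3 * (V3 * J0 + R0 * (V3 - V2)) := by
        rw [← hβ]; ring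
      rw [this] at h5
      linarith
    exact le_of_mul_le_mul_left h6 v3
  have hAB : V2 * V3 * (L * R * ((J0 + L0) * (J0 + R0))) ≤
      V2 * V3 * (L0 * R0 * ((Q * J + L) * (Q * J + R))) :=
    calc V2 * V3 * (L * R * ((J0 + L0) * (J0 + R0)))
        = (L * V2 * (J0 + L0)) * (R * V3 * (J0 + R0)) := by ring
      _ ≤ (L0 * V3 * (Q * J + L)) * (R0 * V2 * (Q * J + R)) := by gcongr
      _ = _ := by ring
  have hAB' := le_of_mul_le_mul_left hAB (by positivity)
  have hQQ : Q ≤ Q ^ 2 := by nlinarith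
  have : L0 * R0 * (J * (L + R)) * Q ≤ L0 * R0 * (J * (L + R)) * Q ^ 2 := by gcongr
  linarith

/-- A degree-one monotone map of the line with a flat interval `[a, b]`, given together with a
monotone semiconjugacy `h` to the irrational rotation by `ρ`, and whose derivative off the flat
interval is the power-law model `(t - b) ^ r * (a + 1 - t) ^ r` times a log-Lipschitz factor. -/
structure FlatCircleMap where
  F : ℝ → ℝ
  h : ℝ → ℝ
  g : ℝ → ℝ
  a : ℝ
  b : ℝ
  ρ : ℝ
  r : ℝ
  C : ℝ
  mono : Monotone F
  cont : Continuous F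
  map_add_one : ∀ x, F (x + 1) = F x + 1
  hab : a < b
  hba : b < a + 1
  flat : ∀ x ∈ Set.Icc a b, F x = F a
  r_pos : 0 < r
  C_nonneg : 0 ≤ C
  lip : ∀ x ∈ Set.Ioo b (a + 1), ∀ y ∈ Set.Ioo b (a + 1), |g x - g y| ≤ C * |x - y|
  hasDerivAt : ∀ t ∈ Set.Ioo b (a + 1),
    HasDerivAt F (Real.exp (g t) * ((t - b) ^ r * (a + 1 - t) ^ r)) t
  irr : Irrational ρ
  h_mono : Monotone h
  h_add_one : ∀ x, h (x + 1) = h x + 1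
  h_map : ∀ x, h (F x) = h x + ρ
  h_a : h a = 0

theorem map_add_int_of_map_add_one {G : ℝ → ℝ} (hG : ∀ x, G (x + 1) = G x + 1) (x : ℝ) (l : ℤ) :
    G (x + l) = G x + l := by
  induction l using Int.induction_on with
  | zero => simp
  | succ i ih => push_cast at *; rw [← add_assoc, hG, ih]; ring
  | pred i ih =>
    have := hG (x + ((-(i : ℤ) - 1 : ℤ) : ℝ))
    push_cast at *
    rw [show x + (-(i : ℝ) - 1) + 1 = x + -(i : ℝ) by ring, ih] at this
    linarith

theorem exists_maximal_preimage {G : ℝ → ℝ} (hc : Continuous G) (hm : Monotone G)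
    (hG : ∀ x, G (x + 1) = G x + 1) (t : ℝ) : ∃ s, G s = t ∧ ∀ s', s < s' → t < G s' := by
  have key := map_add_int_of_map_add_one hG 0
  have hup : t ≤ G (0 + (⌈t - G 0⌉ : ℤ)) := by
    rw [key]; linarith [Int.le_ceil (t - G 0)]
  have hlo : G (0 + (⌊t - G 0⌋ : ℤ)) ≤ t := by
    rw [key]; linarith [Int.floor_le (t - G 0)]
  obtain ⟨s₀, hs₀⟩ : t ∈ Set.range G :=
    mem_range_of_exists_le_of_exists_ge hc ⟨_, hlo⟩ ⟨_, hup⟩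
  have hbdd : BddAbove {s | G s ≤ t} := by
    refine ⟨0 + ((⌈t - G 0⌉ + 1 : ℤ) : ℝ), fun s hs => ?_⟩
    by_contra! hlt
    have h1 := hm hlt.le
    rw [key] at h1
    push_cast at h1
    have := Int.le_ceil (t - G 0)
    have : G s ≤ t := hs
    linarith
  have hcl : IsClosed {s | G s ≤ t} := isClosed_le hc continuous_const
  have hmem : sSup {s | G s ≤ t} ∈ {s | G s ≤ t} := hcl.csSup_mem ⟨s₀, hs₀.le⟩ hbdd
  refine ⟨sSup {s | G s ≤ t}, le_antisymm hmem ?_, fun s' hs' => ?_⟩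
  · exact hs₀.symm.le.trans (hm (le_csSup hbdd hs₀.le))
  · by_contra! hle
    exact absurd (le_csSup hbdd hle) (not_le.2 hs')

theorem exists_minimal_preimage {G : ℝ → ℝ} (hc : Continuous G) (hm : Monotone G)
    (hG : ∀ x, G (x + 1) = G x + 1) (t : ℝ) : ∃ s, G s = t ∧ ∀ s', s' < s → G s' < t := by
  obtain ⟨s, hs, hs'⟩ := exists_maximal_preimage (G := fun x => -G (-x)) (by fun_prop)
    (fun x y hxy => neg_le_neg (hm (neg_le_neg hxy)))
    (fun x => by
      have := hG (-(x + 1))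
      rw [show -(x + 1) + 1 = -x by ring] at this
      linarith) (-t)
  refine ⟨-s, by linarith, fun s' h => ?_⟩
  have := hs' (-s') (by linarith)
  simp only [neg_neg] at this
  linarith

namespace FlatCircleMap

variable (X : FlatCircleMap)

theorem strictMonoOn : StrictMonoOn X.F (Set.Icc X.b (X.a + 1)) := by
  apply strictMonoOn_of_deriv_pos (convex_Icc _ _) X.cont.continuousOn
  rw [interior_Icc]
  intro t ht
  rw [(X.hasDerivAt t ht).deriv]
  have := Real.rpow_pos_of_pos (sub_pos.2 ht.1) X.r
  have := Real.rpow_pos_of_pos (sub_pos.2 ht.2) X.r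
  positivity

theorem iter_mono (n : ℕ) : Monotone X.F^[n] := X.mono.iterate n

theorem iter_cont (n : ℕ) : Continuous X.F^[n] := X.cont.iterate n

theorem iter_add_one (n : ℕ) (x : ℝ) : X.F^[n] (x + 1) = X.F^[n] x + 1 := by
  induction n generalizing x with
  | zero => rfl
  | succ n ih => simp only [Function.iterate_succ_apply, X.map_add_one, ih]

theorem map_add_int (x : ℝ) (l : ℤ) : X.F (x + l) = X.F x + l :=
  map_add_int_of_map_add_one X.map_add_one x l

theorem iter_add_int (n : ℕ) (x : ℝ) (l : ℤ) : X.F^[n] (x + l) = X.F^[n] x + l :=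
  map_add_int_of_map_add_one (X.iter_add_one n) x l

theorem h_add_int (x : ℝ) (l : ℤ) : X.h (x + l) = X.h x + l :=
  map_add_int_of_map_add_one X.h_add_one x l

theorem h_iter (n : ℕ) (x : ℝ) : X.h (X.F^[n] x) = X.h x + n * X.ρ := by
  induction n with
  | zero => simp
  | succ n ih => rw [Function.iterate_succ_apply', X.h_map, ih]; push_cast; ring

theorem lt_of_h_lt {x y : ℝ} (hxy : X.h x < X.h y) : x < y := X.h_mono.reflect_lt hxy

theorem F_b : X.F X.b = X.F X.a := X.flat _ ⟨X.hab.le, le_rfl⟩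

theorem h_eq_zero {x : ℝ} (hx : x ∈ Set.Icc X.a X.b) : X.h x = 0 := by
  have h1 := X.h_map x
  rw [X.flat x hx, X.h_map, X.h_a] at h1
  linarith

theorem h_b : X.h X.b = 0 := X.h_eq_zero ⟨X.hab.le, le_rfl⟩

theorem h_iter_a (n : ℕ) (l : ℤ) : X.h (X.F^[n] X.a + l) = n * X.ρ + l := by
  rw [X.h_add_int, X.h_iter, X.h_a]; ring

theorem iter_flat {n : ℕ} (hn : 1 ≤ n) {x : ℝ} (hx : x ∈ Set.Icc X.a X.b) :
    X.F^[n] x = X.F^[n] X.a := by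
  obtain ⟨m, rfl⟩ := Nat.exists_eq_add_of_le' hn
  rw [Function.iterate_succ_apply, Function.iterate_succ_apply, X.flat x hx]

theorem rotation_inj {j k : ℕ} {l m : ℤ} (h : (j : ℝ) * X.ρ + l = k * X.ρ + m) :
    j = k ∧ l = m := by
  have h1 : ((j : ℤ) - k : ℤ) * X.ρ = ((m - l : ℤ) : ℝ) := by push_cast; linarith
  have h2 : (j : ℤ) - k = 0 := by
    by_contra hne
    exact (X.irr.intCast_mul hne).ne_int _ h1
  have h3 : j = k := by omega
  subst h3
  refine ⟨rfl, ?_⟩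
  have : (l : ℝ) = m := by linarith
  exact_mod_cast this

/-- The mirror image of a flat circle map. -/
def reflect : FlatCircleMap where
  F x := -X.F (-x)
  h x := -X.h (-x)
  g x := X.g (1 - x)
  a := -X.b
  b := -X.a
  ρ := -X.ρ
  r := X.r
  C := X.C
  mono x y hxy := neg_le_neg (X.mono (neg_le_neg hxy))
  cont := (X.cont.comp continuous_neg).neg
  map_add_one x := by
    have := X.map_add_one (-(x + 1))
    rw [show -(x + 1) + 1 = -x by ring] at this
    linarith
  hab := by linarith [X.hab]
  hba := by linarith [X.hba]
  flat x hx := by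
    rw [neg_neg, X.F_b, X.flat (-x) ⟨by linarith [hx.2], by linarith [hx.1]⟩]
  r_pos := X.r_pos
  C_nonneg := X.C_nonneg
  lip x hx y hy := by
    have := X.lip (1 - x) ⟨by linarith [hx.2], by linarith [hx.1]⟩
      (1 - y) ⟨by linarith [hy.2], by linarith [hy.1]⟩
    rwa [show 1 - x - (1 - y) = -(x - y) by ring, abs_neg] at this
  hasDerivAt t ht := by
    have h1 := X.hasDerivAt (1 - t) ⟨by linarith [ht.2], by linarith [ht.1]⟩
    have h2 : HasDerivAt (fun x : ℝ => 1 - x) (-1) t := by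
      simpa using (hasDerivAt_id t).const_sub 1
    have h3 := (h1.comp t h2).neg
    have h4 : (fun x => -X.F (-x)) = fun x => -(X.F ∘ fun x => 1 - x) x + 1 := by
      funext x
      have := X.map_add_one (-x)
      rw [show -x + 1 = 1 - x by ring] at this
      simp [this]
    rw [h4]
    refine (h3.add_const 1).congr_deriv ?_
    rw [show 1 - t - X.b = -X.b + 1 - t by ring, show X.a + 1 - (1 - t) = t - -X.a by ring]
    ring
  irr := X.irr.neg
  h_mono x y hxy := neg_le_neg (X.h_mono (neg_le_neg hxy))
  h_add_one x := by
    have := X.h_add_one (-(x + 1))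
    rw [show -(x + 1) + 1 = -x by ring] at this
    linarith
  h_map x := by
    have := X.h_map (-x)
    rw [neg_neg, this]; ring
  h_a := by rw [neg_neg, X.h_b, neg_zero]

theorem reflect_iter (n : ℕ) (x : ℝ) : X.reflect.F^[n] x = -X.F^[n] (-x) := by
  induction n generalizing x with
  | zero => simp
  | succ n ih =>
    rw [Function.iterate_succ_apply, Function.iterate_succ_apply, ih]
    simp [reflect]

theorem exists_max_preimage (n : ℕ) (t : ℝ) :
    ∃ s, X.F^[n] s = t ∧ ∀ s', s < s' → t < X.F^[n] s' :=
  exists_maximal_preimage (X.iter_cont n) (X.iter_mono n) (X.iter_add_one n) t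

theorem exists_min_preimage (n : ℕ) (t : ℝ) :
    ∃ s, X.F^[n] s = t ∧ ∀ s', s' < s → X.F^[n] s' < t :=
  exists_minimal_preimage (X.iter_cont n) (X.iter_mono n) (X.iter_add_one n) t

/-- The model for `(deriv F) ^ (-1 / 2)`. -/
noncomputable def v (t : ℝ) : ℝ :=
  Real.exp (-(X.r / 2) * (Real.log (t - X.b) + Real.log (X.a + 1 - t)))

theorem convexOn_v : ConvexOn ℝ (Set.Ioo X.b (X.a + 1)) X.v := by
  have h1 : ConcaveOn ℝ (Set.Ioo X.b (X.a + 1)) fun t => Real.log (t - X.b) := by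
    have h := strictConcaveOn_log_Ioi.concaveOn
    refine ⟨convex_Ioo _ _, fun x hx y hy p q hp hq hpq => ?_⟩
    have := h.2 (x := x - X.b) (y := y - X.b) (sub_pos.2 hx.1) (sub_pos.2 hy.1) hp hq hpq
    convert this using 2
    simp only [smul_eq_mul]
    linear_combination X.b * hpq
  have h2 : ConcaveOn ℝ (Set.Ioo X.b (X.a + 1)) fun t => Real.log (X.a + 1 - t) := by
    have h := strictConcaveOn_log_Ioi.concaveOn
    refine ⟨convex_Ioo _ _, fun x hx y hy p q hp hq hpq => ?_⟩
    have := h.2 (x := X.a + 1 - x) (y := X.a + 1 - y) (sub_pos.2 hx.2) (sub_pos.2 hy.2) hp hq hpq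
    convert this using 2
    simp only [smul_eq_mul]
    linear_combination (-X.a - 1) * hpq
  have h3 : ConvexOn ℝ (Set.Ioo X.b (X.a + 1)) fun t =>
      -(X.r / 2) * (Real.log (t - X.b) + Real.log (X.a + 1 - t)) := by
    have := ((h1.add h2).neg.smul (c := X.r / 2) (by linarith [X.r_pos]))
    refine this.congr fun t _ => ?_
    simp
    ring
  exact (convexOn_exp.subset (Set.subset_univ _)
    ((h3.1.isPreconnected.image _ (by
      have hc : ∀ t ∈ Set.Ioo X.b (X.a + 1), t - X.b ≠ 0 ∧ X.a + 1 - t ≠ 0 := fun t ht =>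
        ⟨(sub_pos.2 ht.1).ne', (sub_pos.2 ht.2).ne'⟩
      exact continuousOn_const.mul (((by fun_prop : ContinuousOn (fun t => t - X.b) _).log
        fun t ht => (hc t ht).1).add ((by fun_prop : ContinuousOn (fun t => X.a + 1 - t) _).log
        fun t ht => (hc t ht).2)))).ordConnected.convex)).comp h3
    (Real.exp_monotone.monotoneOn _)

theorem v_pos (t : ℝ) : 0 < X.v t := Real.exp_pos _

theorem hasDerivAt_v {t : ℝ} (ht : t ∈ Set.Ioo X.b (X.a + 1)) :
    HasDerivAt X.F (Real.exp (X.g t) / X.v t ^ 2) t := by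
  refine (X.hasDerivAt t ht).congr_deriv ?_
  rw [div_eq_mul_inv]
  congr 1
  rw [Real.rpow_def_of_pos (sub_pos.2 ht.1), Real.rpow_def_of_pos (sub_pos.2 ht.2), v,
    ← Real.exp_add, ← Real.exp_nat_mul, ← Real.exp_neg]
  congr 1
  push_cast
  ring

/-- The cross-ratio of four points. -/
noncomputable def _root_.crossRatio (x₁ x₂ x₃ x₄ : ℝ) : ℝ :=
  (x₃ - x₂) * (x₄ - x₁) / ((x₂ - x₁) * (x₄ - x₃))

theorem crossRatio_le {x₁ x₂ x₃ x₄ : ℝ} {l : ℤ} (h1 : X.b + l ≤ x₁) (h12 : x₁ < x₂) (h23 : x₂ < x₃)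
    (h34 : x₃ < x₄) (h4 : x₄ ≤ X.a + 1 + l) :
    X.F x₁ < X.F x₂ ∧ X.F x₂ < X.F x₃ ∧ X.F x₃ < X.F x₄ ∧
    crossRatio x₁ x₂ x₃ x₄ ≤
      Real.exp (4 * X.C * (x₄ - x₁)) * crossRatio (X.F x₁) (X.F x₂) (X.F x₃) (X.F x₄) := by
  obtain ⟨y₁, rfl⟩ : ∃ y, x₁ = y + l := ⟨x₁ - l, by ring⟩
  obtain ⟨y₂, rfl⟩ : ∃ y, x₂ = y + l := ⟨x₂ - l, by ring⟩
  obtain ⟨y₃, rfl⟩ : ∃ y, x₃ = y + l := ⟨x₃ - l, by ring⟩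
  obtain ⟨y₄, rfl⟩ : ∃ y, x₄ = y + l := ⟨x₄ - l, by ring⟩
  simp only [X.map_add_int, crossRatio, add_sub_add_right_eq_sub]
  have g1 : X.b ≤ y₁ := by linarith
  have g12 : y₁ < y₂ := by linarith
  have g23 : y₂ < y₃ := by linarith
  have g34 : y₃ < y₄ := by linarith
  have g4 : y₄ ≤ X.a + 1 := by linarith
  have s := X.strictMonoOn
  have f12 := s ⟨g1, by linarith⟩ ⟨by linarith, by linarith⟩ g12
  have f23 := s ⟨by linarith, by linarith⟩ ⟨by linarith, by linarith⟩ g23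
  have f34 := s ⟨by linarith, by linarith⟩ ⟨by linarith, by linarith⟩ g34
  refine ⟨by linarith, by linarith, by linarith, ?_⟩
  have := cross_ratio_le_of_deriv_eq (ω := X.C * (y₄ - y₁)) X.cont.continuousOn
    (fun t ht => X.hasDerivAt_v ht) X.convexOn_v (fun t _ => X.v_pos t) s g1 g12 g23 g34 g4
    (fun t ht => (X.lip t ⟨by linarith [ht.1], by linarith [ht.2]⟩ y₂
      ⟨by linarith, by linarith⟩).trans (mul_le_mul_of_nonneg_left
        (abs_le.2 ⟨by linarith [ht.1], by linarith [ht.2]⟩) X.C_nonneg))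
  rw [← mul_div_assoc, div_le_div_iff₀ (mul_pos (by linarith) (by linarith))
    (mul_pos (by linarith) (by linarith))]
  rw [show 4 * X.C * (y₄ - y₁) = 4 * (X.C * (y₄ - y₁)) by ring, mul_assoc (Real.exp _)]
  exact this

end FlatCircleMap

namespace FlatCircleMap

variable (X : FlatCircleMap)

theorem crossRatio_le_iterate (n : ℕ) {s₁ s₂ s₃ s₄ : ℝ} (h12 : s₁ < s₂) (h23 : s₂ < s₃)
    (h34 : s₃ < s₄)
    (hloc : ∀ k < n, ∃ l : ℤ, X.b + l ≤ X.F^[k] s₁ ∧ X.F^[k] s₄ ≤ X.a + 1 + l) :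
    X.F^[n] s₁ < X.F^[n] s₂ ∧ X.F^[n] s₂ < X.F^[n] s₃ ∧ X.F^[n] s₃ < X.F^[n] s₄ ∧
    crossRatio s₁ s₂ s₃ s₄ ≤
      Real.exp (4 * X.C * ∑ k ∈ Finset.range n, (X.F^[k] s₄ - X.F^[k] s₁)) *
        crossRatio (X.F^[n] s₁) (X.F^[n] s₂) (X.F^[n] s₃) (X.F^[n] s₄) := by
  induction n with
  | zero => simp [h12, h23, h34]
  | succ n ih =>
    obtain ⟨i12, i23, i34, hle⟩ := ih fun k hk => hloc k (by omega)
    obtain ⟨l, hl, hl'⟩ := hloc n (by omega)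
    obtain ⟨j12, j23, j34, hle'⟩ := X.crossRatio_le hl i12 i23 i34 hl'
    simp only [Function.iterate_succ_apply']
    refine ⟨j12, j23, j34, hle.trans ?_⟩
    rw [Finset.sum_range_succ, mul_add, Real.exp_add, mul_assoc (Real.exp _)]
    exact mul_le_mul_of_nonneg_left hle' (Real.exp_pos _).le

/-- If the orbit of the flat interval misses `(t₁, t₄)` up to time `n`, the pullback of
`[t₁, t₄]` stays in the fundamental domains `[b + l, a + 1 + l]`. -/
theorem exists_int_pullback_subset {n : ℕ} {t₁ t₄ s₁ s₄ : ℝ} (ht : t₁ < t₄)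
    (hs₁ : X.F^[n] s₁ = t₁) (hmax : ∀ s', s₁ < s' → t₁ < X.F^[n] s')
    (hs₄ : X.F^[n] s₄ = t₄) (hmin : ∀ s', s' < s₄ → X.F^[n] s' < t₄)
    (hmiss : ∀ k : ℕ, 1 ≤ k → k ≤ n → ∀ l : ℤ, t₁ < X.F^[k] X.a + l → t₄ ≤ X.F^[k] X.a + l)
    {k : ℕ} (hk : k < n) : ∃ l : ℤ, X.b + l ≤ X.F^[k] s₁ ∧ X.F^[k] s₄ ≤ X.a + 1 + l := by
  have hs : s₁ < s₄ := (X.iter_mono n).reflect_lt (by rwa [hs₁, hs₄])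
  refine ⟨⌊X.F^[k] s₁ - X.b⌋, by linarith [Int.floor_le (X.F^[k] s₁ - X.b)], ?_⟩
  set l := ⌊X.F^[k] s₁ - X.b⌋ with hl
  have hlt := Int.lt_floor_add_one (X.F^[k] s₁ - X.b)
  rw [← hl] at hlt
  by_contra! hcon
  have hlt' : X.F^[k] s₁ < X.F^[k] s₄ := by
    refine lt_of_le_of_ne (X.iter_mono k hs.le) fun heq => ?_
    obtain ⟨m, rfl⟩ := Nat.exists_eq_add_of_le' hk.le
    rw [Function.iterate_add_apply] at hs₁ hs₄
    rw [heq, hs₄] at hs₁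
    exact ht.ne' hs₁
  obtain ⟨θ, hθ, hθ'⟩ : ∃ θ, max (X.F^[k] s₁) (X.a + 1 + l) < θ ∧
      θ < min (X.F^[k] s₄) (X.b + 1 + l) :=
    exists_between (max_lt (lt_min hlt' (by linarith)) (lt_min hcon (by linarith [X.hab])))
  rw [max_lt_iff] at hθ
  rw [lt_min_iff] at hθ'
  obtain ⟨s, hs, hsθ⟩ := intermediate_value_Ioo hs.le (X.iter_cont k).continuousOn ⟨hθ.1, hθ'.1⟩
  have h1 : X.F^[n] s = X.F^[n - k] X.a + (l + 1 : ℤ) := by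
    obtain ⟨m, rfl⟩ := Nat.exists_eq_add_of_le' hk.le
    rw [Function.iterate_add_apply, hsθ, Nat.add_sub_cancel,
      ← X.iter_flat (n := m) (x := θ - (l + 1 : ℤ)) (by omega) (by
        push_cast; exact ⟨by linarith [hθ.2], by linarith [hθ'.2]⟩), ← X.iter_add_int,
      sub_add_cancel]
  have h2 := hmax s hs.1
  have h3 := hmin s hs.2
  rw [h1] at h2 h3
  exact absurd (hmiss (n - k) (by omega) (by omega) _ h2) (not_le.2 h3)

theorem card_le_of_separated {ι : Type*} (s : Finset ι) (φ : ι → ℝ) {μ t : ℝ} (hμ : 0 < μ) {N : ℕ}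
    (hlo : ∀ i ∈ s, t ≤ φ i) (hhi : ∀ i ∈ s, φ i ≤ t + N * μ)
    (hsep : ∀ i ∈ s, ∀ j ∈ s, i ≠ j → μ ≤ |φ i - φ j|) : s.card ≤ N + 1 := by
  have : (N + 1) = (Finset.range (N + 1)).card := by simp
  rw [this]
  refine Finset.card_le_card_of_injOn (fun i => ⌊(φ i - t) / μ⌋₊) (fun i hi => ?_)
    fun i hi j hj hij => ?_
  · simp only [Finset.coe_range, Set.mem_Iio]
    rw [Nat.lt_succ_iff]
    apply Nat.floor_le_of_le
    rw [div_le_iff₀ hμ]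
    linarith [hhi i hi]
  · by_contra hne
    have h1 := hsep i hi j hj hne
    simp only at hij
    have hi0 : 0 ≤ (φ i - t) / μ := div_nonneg (by linarith [hlo i hi]) hμ.le
    have hj0 : 0 ≤ (φ j - t) / μ := div_nonneg (by linarith [hlo j hj]) hμ.le
    have a1 := Nat.floor_le hi0
    have a2 := Nat.floor_le hj0
    have b1 := Nat.lt_floor_add_one ((φ i - t) / μ)
    have b2 := Nat.lt_floor_add_one ((φ j - t) / μ)
    rw [hij] at a1 b1
    have h2 : |(φ i - t) / μ - (φ j - t) / μ| < 1 := abs_lt.2 ⟨by linarith, by linarith⟩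
    rw [← sub_div, abs_div, abs_of_pos hμ, div_lt_one hμ, sub_sub_sub_cancel_right] at h2
    linarith

theorem sum_length_le {ι : Type*} (s : Finset ι) (u w : ι → ℝ) {p q : ℝ} (hpq : p ≤ q) {N : ℕ}
    (hp : ∀ i ∈ s, p ≤ u i) (hq : ∀ i ∈ s, w i ≤ q)
    (hN : ∀ θ, (s.filter fun i => θ ∈ Set.Ioc (u i) (w i)).card ≤ N) :
    ∑ i ∈ s, (w i - u i) ≤ N * (q - p) := by
  have h1 : ∑ i ∈ s, MeasureTheory.volume (Set.Ioc (u i) (w i)) ≤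
      (N : ENNReal) * MeasureTheory.volume (Set.Ioc p q) := by
    calc ∑ i ∈ s, MeasureTheory.volume (Set.Ioc (u i) (w i))
        = ∫⁻ θ, ∑ i ∈ s, (Set.Ioc (u i) (w i)).indicator 1 θ := by
          rw [MeasureTheory.lintegral_finsetSum _ fun i _ =>
            measurable_one.indicator measurableSet_Ioc]
          exact Finset.sum_congr rfl fun i _ =>
            (MeasureTheory.lintegral_indicator_one measurableSet_Ioc).symm
      _ ≤ ∫⁻ θ, (Set.Ioc p q).indicator (fun _ => (N : ENNReal)) θ := by
          refine MeasureTheory.lintegral_mono fun θ => ?_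
          by_cases hθ : θ ∈ Set.Ioc p q
          · rw [Set.indicator_of_mem hθ]
            simp only [Set.indicator_apply, Pi.one_apply]
            rw [Finset.sum_boole]
            exact_mod_cast hN θ
          · rw [Set.indicator_of_notMem hθ, Finset.sum_eq_zero]
            intro i hi
            refine Set.indicator_of_notMem (fun hmem => hθ ?_) _
            exact ⟨(hp i hi).trans_lt hmem.1, hmem.2.trans (hq i hi)⟩
      _ = _ := MeasureTheory.lintegral_indicator_const measurableSet_Ioc _
  simp only [Real.volume_Ioc] at h1
  have h2 : ENNReal.ofReal (∑ i ∈ s, (w i - u i)) ≤ ENNReal.ofReal (N * (q - p)) := by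
    rw [ENNReal.ofReal_mul (by positivity), ENNReal.ofReal_natCast]
    refine le_trans ?_ h1
    calc ENNReal.ofReal (∑ i ∈ s, (w i - u i))
        ≤ ENNReal.ofReal (∑ i ∈ s, max (w i - u i) 0) :=
          ENNReal.ofReal_le_ofReal (Finset.sum_le_sum fun i _ => le_max_left _ _)
      _ = ∑ i ∈ s, ENNReal.ofReal (max (w i - u i) 0) :=
          ENNReal.ofReal_sum_of_nonneg fun i _ => le_max_right _ _
      _ = _ := by simp
  exact (ENNReal.ofReal_le_ofReal_iff (mul_nonneg (by positivity) (by linarith))).1 h2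

theorem sum_pullback_length_le {n : ℕ} {s₁ s₄ μ : ℝ} (hμ : 0 < μ)
    (hsep : ∀ k : ℕ, 1 ≤ k → k < n → ∀ l : ℤ, μ ≤ |k * X.ρ + l|)
    (hw : X.h (X.F^[n] s₄) - X.h (X.F^[n] s₁) ≤ 6 * μ)
    (hloc : ∀ k < n, ∃ l : ℤ, X.b + l ≤ X.F^[k] s₁ ∧ X.F^[k] s₄ ≤ X.a + 1 + l) :
    ∑ k ∈ Finset.range n, (X.F^[k] s₄ - X.F^[k] s₁) ≤ 7 := by
  choose! l hl hl' using hloc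
  have key : ∑ k ∈ Finset.range n, ((X.F^[k] s₄ - l k) - (X.F^[k] s₁ - l k)) ≤
      (7 : ℕ) * ((X.a + 1) - X.b) := by
    refine sum_length_le _ _ _ X.hba.le (fun k hk => ?_) (fun k hk => ?_) fun θ => ?_
    · linarith [hl k (Finset.mem_range.1 hk)]
    · linarith [hl' k (Finset.mem_range.1 hk)]
    · refine card_le_of_separated (N := 6) _
        (fun k => X.h (X.F^[n - k] (θ + l k))) hμ (t := X.h (X.F^[n] s₁)) ?_ ?_ ?_
      · intro k hk
        simp only [Finset.mem_filter, Finset.mem_range, Set.mem_Ioc] at hk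
        apply X.h_mono
        have := X.iter_mono (n - k) (show X.F^[k] s₁ ≤ θ + l k by linarith [hk.2.1])
        rwa [← Function.iterate_add_apply, Nat.sub_add_cancel hk.1.le] at this
      · intro k hk
        simp only [Finset.mem_filter, Finset.mem_range, Set.mem_Ioc] at hk
        have := X.iter_mono (n - k) (show θ + l k ≤ X.F^[k] s₄ by linarith [hk.2.2])
        rw [← Function.iterate_add_apply, Nat.sub_add_cancel hk.1.le] at this
        have := X.h_mono this
        push_cast
        linarith
      · have main : ∀ i j : ℕ, i < n → i < j → j < n →
            μ ≤ |X.h (X.F^[n - i] (θ + l i)) - X.h (X.F^[n - j] (θ + l j))| := by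
          intro i j hi hij hj
          have := hsep (j - i) (by omega) (by omega) (l i - l j)
          rw [X.h_iter, X.h_iter, X.h_add_int, X.h_add_int]
          convert this using 2
          push_cast [Nat.cast_sub hi.le, Nat.cast_sub hij.le, Nat.cast_sub hj.le]
          ring
        intro i hi j hj hij
        simp only [Finset.mem_filter, Finset.mem_range] at hi hj
        rcases lt_or_gt_of_ne hij with h | h
        · exact main i j hi.1 h hj.1
        · rw [abs_sub_comm]; exact main j i hj.1 h hi.1
  simp only [sub_sub_sub_cancel_right] at key
  have := X.hab
  push_cast at key
  linarith

theorem crossRatio_pullback_le {n : ℕ} {t₁ t₄ s₁ s₂ s₃ s₄ μ : ℝ} (hμ : 0 < μ)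
    (hsep : ∀ k : ℕ, 1 ≤ k → k < n → ∀ l : ℤ, μ ≤ |k * X.ρ + l|)
    (hs₁ : X.F^[n] s₁ = t₁) (hmax : ∀ s', s₁ < s' → t₁ < X.F^[n] s')
    (hs₄ : X.F^[n] s₄ = t₄) (hmin : ∀ s', s' < s₄ → X.F^[n] s' < t₄)
    (hmiss : ∀ k : ℕ, 1 ≤ k → k ≤ n → ∀ l : ℤ, t₁ < X.F^[k] X.a + l → t₄ ≤ X.F^[k] X.a + l)
    (hw : X.h t₄ - X.h t₁ ≤ 6 * μ) (h12 : s₁ < s₂) (h23 : s₂ < s₃) (h34 : s₃ < s₄) :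
    t₁ < X.F^[n] s₂ ∧ X.F^[n] s₂ < X.F^[n] s₃ ∧ X.F^[n] s₃ < t₄ ∧
    crossRatio s₁ s₂ s₃ s₄ ≤
      Real.exp (28 * X.C) * crossRatio t₁ (X.F^[n] s₂) (X.F^[n] s₃) t₄ := by
  have ht : t₁ < t₄ := by
    rw [← hs₄]; exact hmax _ (by linarith)
  have hloc := fun k (hk : k < n) =>
    X.exists_int_pullback_subset ht hs₁ hmax hs₄ hmin hmiss hk
  obtain ⟨g12, g23, g34, hle⟩ := X.crossRatio_le_iterate n h12 h23 h34 hloc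
  rw [hs₁] at g12 hle
  rw [hs₄] at g34 hle
  refine ⟨g12, g23, g34, hle.trans ?_⟩
  have hsum := X.sum_pullback_length_le (s₁ := s₁) (s₄ := s₄) hμ hsep (by rwa [hs₁, hs₄]) hloc
  have := X.C_nonneg
  have h0 : 0 ≤ crossRatio t₁ (X.F^[n] s₂) (X.F^[n] s₃) t₄ := by
    refine div_nonneg (mul_nonneg ?_ ?_) (mul_nonneg ?_ ?_) <;> linarith
  refine mul_le_mul_of_nonneg_right (Real.exp_le_exp.2 ?_) h0
  nlinarith

end FlatCircleMap

namespace FlatCircleMap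

variable (X : FlatCircleMap)

theorem deriv_bounds {t : ℝ} (ht : t ∈ Set.Ioo X.b (X.a + 1)) :
    Real.exp (X.g ((X.b + (X.a + 1)) / 2) - X.C) ≤ Real.exp (X.g t) ∧
      Real.exp (X.g t) ≤ Real.exp (X.g ((X.b + (X.a + 1)) / 2) + X.C) := by
  have hab := X.hab
  have hba := X.hba
  have h := X.lip t ht ((X.b + (X.a + 1)) / 2) ⟨by linarith, by linarith⟩
  have h1 : |t - (X.b + (X.a + 1)) / 2| ≤ 1 := abs_le.2 ⟨by linarith [ht.1], by linarith [ht.2]⟩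
  have h2 := abs_le.1 (h.trans (mul_le_of_le_one_right X.C_nonneg h1))
  exact ⟨Real.exp_le_exp.2 (by linarith), Real.exp_le_exp.2 (by linarith)⟩

/-- Comparability of adjacent lengths pulls back through the critical value at `b`. -/
theorem exists_forall_sub_le_right {K : ℝ} (hK : 0 < K) : ∃ K' > 0, ∀ v u, X.b < v → v < u →
    u ≤ X.a + 1 → X.F v - X.F X.b ≤ K * (X.F u - X.F v) → v - X.b ≤ K' * (u - v) := by
  have hab := X.hab
  have hba := X.hba
  have hr := X.r_pos
  set L := X.a + 1 - X.b with hL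
  have hL0 : 0 < L := by linarith
  set M := Real.exp (X.g ((X.b + (X.a + 1)) / 2) + X.C) with hM
  set m := Real.exp (X.g ((X.b + (X.a + 1)) / 2) - X.C) with hm
  have hm0 : 0 < m := Real.exp_pos _
  have hM0 : 0 < M := Real.exp_pos _
  have hLr : 0 < (L / 2) ^ X.r := Real.rpow_pos_of_pos (by linarith) _
  have h8 : 0 < (8 : ℝ) ^ X.r := Real.rpow_pos_of_pos (by norm_num) _
  refine ⟨1 + 4 * K * M * 8 ^ X.r / (m * (L / 2) ^ X.r), by positivity, fun v u hv hu hu' hF => ?_⟩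
  have hp : 0 < 4 * K * M * 8 ^ X.r / (m * (L / 2) ^ X.r) := by positivity
  by_cases hcase : v - X.b ≤ u - v
  · nlinarith
  push Not at hcase
  set V := v - X.b with hV
  have hV0 : 0 < V := by linarith
  have hup : X.F u - X.F v ≤ M * (2 * V) ^ X.r * (u - v) := by
    obtain ⟨c, hc, hc'⟩ := exists_hasDerivAt_eq_slope X.F _ hu X.cont.continuousOn
      fun x hx => X.hasDerivAt x ⟨by linarith [hx.1], by linarith [hx.2]⟩
    rw [eq_div_iff (by linarith)] at hc'
    rw [← hc']
    have hcI : c ∈ Set.Ioo X.b (X.a + 1) := ⟨by linarith [hc.1], by linarith [hc.2]⟩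
    refine mul_le_mul_of_nonneg_right ?_ (by linarith)
    refine mul_le_mul (X.deriv_bounds hcI).2 ?_ ?_ hM0.le
    · calc (c - X.b) ^ X.r * (X.a + 1 - c) ^ X.r ≤ (2 * V) ^ X.r * 1 := by
            refine mul_le_mul (Real.rpow_le_rpow (by linarith [hcI.1]) (by linarith [hc.2]) hr.le)
              (Real.rpow_le_one (by linarith [hcI.2]) (by linarith [hcI.1]) hr.le)
              (Real.rpow_nonneg (by linarith [hcI.2]) _) (Real.rpow_nonneg (by linarith) _)
        _ = _ := mul_one _
    · exact mul_nonneg (Real.rpow_nonneg (by linarith [hcI.1]) _)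
        (Real.rpow_nonneg (by linarith [hcI.2]) _)
  have hlo : m * ((V / 4) ^ X.r * (L / 2) ^ X.r) * (V / 4) ≤ X.F v - X.F X.b := by
    obtain ⟨c, hc, hc'⟩ := exists_hasDerivAt_eq_slope X.F _
      (show X.b + V / 4 < X.b + V / 2 by linarith) X.cont.continuousOn
      fun x hx => X.hasDerivAt x ⟨by linarith [hx.1], by linarith [hx.2]⟩
    rw [eq_div_iff (by linarith)] at hc'
    have hcI : c ∈ Set.Ioo X.b (X.a + 1) := ⟨by linarith [hc.1], by linarith [hc.2]⟩
    have h1 : X.F X.b ≤ X.F (X.b + V / 4) := X.mono (by linarith)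
    have h2 : X.F (X.b + V / 2) ≤ X.F v := X.mono (by linarith)
    refine le_trans ?_ (show X.F (X.b + V / 2) - X.F (X.b + V / 4) ≤ _ by linarith)
    rw [← hc', show X.b + V / 2 - (X.b + V / 4) = V / 4 by ring]
    refine mul_le_mul_of_nonneg_right ?_ (by linarith)
    refine mul_le_mul (X.deriv_bounds hcI).1 ?_ (by positivity) (Real.exp_pos _).le
    exact mul_le_mul (Real.rpow_le_rpow (by linarith) (by linarith [hc.1]) hr.le)
      (Real.rpow_le_rpow (by linarith) (by linarith [hc.2]) hr.le) hLr.le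
      (Real.rpow_nonneg (by linarith [hcI.1]) _)
  have h2V : (2 * V) ^ X.r = 8 ^ X.r * (V / 4) ^ X.r := by
    rw [← Real.mul_rpow (by norm_num) (by linarith)]; congr 1; ring
  have hV4 : 0 < (V / 4) ^ X.r := Real.rpow_pos_of_pos (by linarith) _
  have h3 := hlo.trans (hF.trans (mul_le_mul_of_nonneg_left hup hK.le))
  rw [h2V] at h3
  have h4 : m * (L / 2) ^ X.r * V ≤ 4 * K * M * 8 ^ X.r * (u - v) := by
    refine le_of_mul_le_mul_left (a := (V / 4) ^ X.r) ?_ hV4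
    linarith
  have h5 : V ≤ 4 * K * M * 8 ^ X.r / (m * (L / 2) ^ X.r) * (u - v) := by
    rw [div_mul_eq_mul_div, le_div_iff₀ (by positivity)]
    linarith
  linarith

theorem exists_forall_sub_le_left {K : ℝ} (hK : 0 < K) : ∃ K' > 0, ∀ u v, X.b - 1 ≤ u → u < v →
    v < X.a → X.F X.a - X.F v ≤ K * (X.F v - X.F u) → X.a - v ≤ K' * (v - u) := by
  obtain ⟨K', hK', h⟩ := X.reflect.exists_forall_sub_le_right hK
  refine ⟨K', hK', fun u v hu huv hv hF => ?_⟩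
  have := h (-v) (-u) (by simp [reflect, hv]) (by linarith)
    (by simp only [reflect]; linarith) (by simp only [reflect, neg_neg]; linarith)
  simp only [reflect] at this
  linarith

end FlatCircleMap

theorem sub_le_of_crossRatio_le_right {x₁ x₂ x₃ x₄ K : ℝ} (h12 : x₁ < x₂) (h23 : x₂ < x₃)
    (h34 : x₃ < x₄) (h : crossRatio x₁ x₂ x₃ x₄ ≤ K) : x₃ - x₂ ≤ K * (x₄ - x₃) := by
  have p1 : 0 < x₂ - x₁ := by linarith
  have p2 : 0 < x₄ - x₃ := by linarith
  rw [crossRatio, div_le_iff₀ (mul_pos p1 p2)] at h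
  refine le_of_mul_le_mul_left (a := x₂ - x₁) ?_ p1
  nlinarith [mul_pos (show 0 < x₃ - x₂ by linarith) (show 0 < x₄ - x₂ by linarith)]

theorem sub_le_of_crossRatio_le_left {x₁ x₂ x₃ x₄ K : ℝ} (h12 : x₁ < x₂) (h23 : x₂ < x₃)
    (h34 : x₃ < x₄) (h : crossRatio x₁ x₂ x₃ x₄ ≤ K) : x₃ - x₂ ≤ K * (x₂ - x₁) := by
  have p1 : 0 < x₂ - x₁ := by linarith
  have p2 : 0 < x₄ - x₃ := by linarith
  rw [crossRatio, div_le_iff₀ (mul_pos p1 p2)] at h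
  refine le_of_mul_le_mul_left (a := x₄ - x₃) ?_ p2
  nlinarith [mul_pos (show 0 < x₃ - x₂ by linarith) (show 0 < x₃ - x₁ by linarith)]

theorem exists_nat_int_abs_add_lt {ρ : ℝ} (hρ : Irrational ρ) (x : ℝ) {δ : ℝ} (hδ : 0 < δ) :
    ∃ n : ℕ, ∃ l : ℤ, |x + n * ρ + l| < δ := by
  obtain ⟨N, hN⟩ := exists_nat_gt (1 / δ)
  have hN0 : 0 < N := by
    have : (0 : ℝ) < N := lt_trans (by positivity) hN
    exact_mod_cast this
  obtain ⟨p, q, hq, -, hpq⟩ := Real.exists_int_int_abs_mul_sub_le ρ hN0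
  have hlt : |(q : ℝ) * ρ - p| < δ := by
    refine hpq.trans_lt ?_
    rw [div_lt_iff₀ (by positivity)]
    rw [div_lt_iff₀ hδ] at hN
    linarith
  have hne : (q : ℝ) * ρ - p ≠ 0 := by
    intro h
    exact (hρ.intCast_mul hq.ne').ne_int p (by linarith)
  obtain ⟨m, rfl⟩ := Int.eq_ofNat_of_zero_le hq.le
  push_cast at hlt hne
  rcases lt_or_gt_of_ne hne with h | h
  · set e := p - (m : ℝ) * ρ with he
    have he0 : 0 < e := by linarith
    have hy : 0 ≤ (x - ⌊x⌋) / e := div_nonneg (by linarith [Int.floor_le x]) he0.le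
    refine ⟨⌊(x - ⌊x⌋) / e⌋₊ * m, -⌊x⌋ - ⌊(x - ⌊x⌋) / e⌋₊ * p, ?_⟩
    have h1 := Nat.floor_le hy
    have h2 := Nat.lt_floor_add_one ((x - ⌊x⌋) / e)
    rw [le_div_iff₀ he0] at h1
    rw [div_lt_iff₀ he0] at h2
    have h3 : e < δ := by rw [abs_of_neg h] at hlt; linarith
    push_cast
    rw [abs_lt]
    constructor <;> simp only [he] at * <;> nlinarith
  · set e := (m : ℝ) * ρ - p with he
    have he0 : 0 < e := by linarith
    have hy : 0 ≤ (⌈x⌉ - x) / e := div_nonneg (by linarith [Int.le_ceil x]) he0.le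
    refine ⟨⌊(⌈x⌉ - x) / e⌋₊ * m, -⌈x⌉ - ⌊(⌈x⌉ - x) / e⌋₊ * p, ?_⟩
    have h1 := Nat.floor_le hy
    have h2 := Nat.lt_floor_add_one ((⌈x⌉ - x) / e)
    rw [le_div_iff₀ he0] at h1
    rw [div_lt_iff₀ he0] at h2
    have h3 : e < δ := by rw [abs_of_pos h] at hlt; linarith
    push_cast
    rw [abs_lt]
    constructor <;> simp only [he] at * <;> nlinarith

namespace FlatCircleMap

variable (X : FlatCircleMap)

/-- A closest return `F^[D] a + l` of the flat interval on its left, with definite space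
`(w, F^[D] a + l)` beyond it that is free of the intermediate orbit. -/
structure GoodReturn (κ μ : ℝ) (D : ℕ) (l : ℤ) (w : ℝ) : Prop where
  one_le : 1 ≤ D
  sep : ∀ k : ℕ, 1 ≤ k → k ≤ D → ∀ m : ℤ, μ ≤ |k * X.ρ + m|
  neg : D * X.ρ + l < 0
  gt : -(2 * μ) < D * X.ρ + l
  closest : ∀ k : ℕ, 1 ≤ k → k ≤ D → ∀ m : ℤ, k * X.ρ + m < 0 → k * X.ρ + m ≤ D * X.ρ + l
  w_lt : w < X.F^[D] X.a + l
  space : κ * (X.a - (X.F^[D] X.a + l)) ≤ X.F^[D] X.a + l - w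
  h_w : D * X.ρ + l - 2 * μ ≤ X.h w
  miss : ∀ k : ℕ, 1 ≤ k → k < D → ∀ m : ℤ, w < X.F^[k] X.a + m → X.a ≤ X.F^[k] X.a + m

variable {X}

namespace GoodReturn

variable {κ μ : ℝ} {D : ℕ} {l : ℤ} {w : ℝ}

theorem mul_add_ne_zero {k : ℕ} (hk : 1 ≤ k) (m : ℤ) : (k : ℝ) * X.ρ + m ≠ 0 := by
  intro h
  have := X.rotation_inj (j := k) (k := 0) (l := m) (m := 0) (by push_cast; linarith)
  omega

theorem miss_b (G : X.GoodReturn κ μ D l w) {k : ℕ} (hk : 1 ≤ k) (hkD : k < D) (m : ℤ)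
    (h : w < X.F^[k] X.a + m) : X.b ≤ X.F^[k] X.a + m := by
  by_contra! hcon
  have h1 := X.h_eq_zero ⟨G.miss k hk hkD m h, hcon.le⟩
  rw [X.h_iter_a] at h1
  exact mul_add_ne_zero hk m h1

theorem b_sub_w_le (G : X.GoodReturn κ μ D l w) (hμ : μ ≤ 1 / 8) : X.b - w ≤ 1 := by
  by_contra! hcon
  have h1 := X.h_mono (show w + 1 ≤ X.b by linarith)
  rw [X.h_add_one, X.h_b] at h1
  linarith [G.h_w, G.gt]

/-- Points entering the closest-return neighbourhood on the left of the flat interval. -/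
theorem exists_gap_of_neg (G : X.GoodReturn κ μ D l w) (hκ : 0 < κ) (hμ : 0 < μ)
    (hμ' : μ ≤ 1 / 8) {x : ℝ} {n : ℕ} (hneg : X.h (X.F^[n] x) < 0)
    (hgt : D * X.ρ + l < X.h (X.F^[n] x))
    (hfirst : ∀ m < n, ∀ i : ℤ, -(D * X.ρ + l) ≤ |X.h (X.F^[m] x) + i|) :
    ∃ s s' : ℝ, s < s' ∧ (∀ t ∈ Set.Ioo s s', X.F^[n] t ∈ Set.Ioo X.a X.b) ∧ x ≤ s ∧
      s - x ≤ Real.exp (28 * X.C) * (1 / (κ * (X.b - X.a))) * (s' - s) := by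
  have hab := X.hab
  have hnD : n < D := by
    by_contra! hle
    have h1 := hfirst (n - D) (by have := G.one_le; omega) (-l)
    have h2 : X.h (X.F^[n] x) = X.h (X.F^[n - D] x) + D * X.ρ := by
      rw [X.h_iter, X.h_iter, Nat.cast_sub hle]; ring
    rw [abs_of_pos (by push_cast; linarith)] at h1
    push_cast at h1
    linarith
  set y := X.F^[n] x with hy
  have hPy : X.F^[D] X.a + l < y := X.lt_of_h_lt (by rwa [X.h_iter_a])
  have hya : y < X.a := X.lt_of_h_lt (by rwa [X.h_a])
  have hwlt := G.w_lt
  obtain ⟨s₁, hs₁, hmax⟩ := X.exists_max_preimage n w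
  obtain ⟨s₃, hs₃, hmax₃⟩ := X.exists_max_preimage n X.a
  obtain ⟨s₄, hs₄, hmin⟩ := X.exists_min_preimage n X.b
  have h12 : s₁ < x := (X.iter_mono n).reflect_lt (by rw [hs₁, ← hy]; linarith)
  have h23 : x < s₃ := (X.iter_mono n).reflect_lt (by rw [hs₃, ← hy]; linarith)
  have h34 : s₃ < s₄ := (X.iter_mono n).reflect_lt (by rw [hs₃, hs₄]; linarith)
  obtain ⟨-, -, -, hcr⟩ := X.crossRatio_pullback_le hμ
    (fun k hk hkn => G.sep k hk (by omega)) hs₁ hmax hs₄ hmin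
    (fun k hk hkn m => G.miss_b hk (by omega) m) (by rw [X.h_b]; linarith [G.h_w, G.gt])
    h12 h23 h34
  rw [← hy, hs₃] at hcr
  refine ⟨s₃, s₄, h34, fun t ht => ⟨hmax₃ t ht.1, hmin t ht.2⟩, h23.le, ?_⟩
  refine sub_le_of_crossRatio_le_right h12 h23 h34 (hcr.trans ?_)
  refine mul_le_mul_of_nonneg_left ?_ (Real.exp_pos _).le
  rw [crossRatio, div_le_div_iff₀ (mul_pos (by linarith) (by linarith))
    (mul_pos hκ (by linarith)), one_mul]
  have h1 : κ * (X.a - y) ≤ y - w := by nlinarith [G.space]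
  have h2 := G.b_sub_w_le hμ'
  have h3 : (X.a - y) * (X.b - w) ≤ X.a - y := mul_le_of_le_one_right (by linarith) h2
  calc (X.a - y) * (X.b - w) * (κ * (X.b - X.a))
      ≤ (X.a - y) * (κ * (X.b - X.a)) :=
        mul_le_mul_of_nonneg_right h3 (mul_nonneg hκ.le (by linarith))
    _ = κ * (X.a - y) * (X.b - X.a) := by ring
    _ ≤ _ := mul_le_mul_of_nonneg_right h1 (by linarith)

/-- Points entering the closest-return neighbourhood on the right of the flat interval. -/
theorem exists_gap_of_pos (G : X.GoodReturn κ μ D l w) (hκ : 0 < κ) (hμ : 0 < μ)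
    (hμ' : μ ≤ 1 / 8) {K' : ℝ} (hK' : ∀ v u, X.b < v → v < u → u ≤ X.a + 1 →
      X.F v - X.F X.b ≤ Real.exp (28 * X.C) * (1 / (κ * (X.b - X.a))) * (X.F u - X.F v) →
      v - X.b ≤ K' * (u - v)) {x : ℝ} {n : ℕ} (hpos : 0 < X.h (X.F^[n] x))
    (hlt : X.h (X.F^[n] x) < -(D * X.ρ + l))
    (hfirst : ∀ m < n, ∀ i : ℤ, -(D * X.ρ + l) ≤ |X.h (X.F^[m] x) + i|) :
    ∃ s s' : ℝ, s < s' ∧ (∀ t ∈ Set.Ioo s s', X.F^[n] t ∈ Set.Ioo X.a X.b) ∧ s' ≤ x ∧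
      x - s' ≤ Real.exp (28 * X.C) * (K' / (X.b - X.a)) * (s' - s) := by
  have hab := X.hab
  have hD := G.one_le
  have hwlt := G.w_lt
  set δ := -(D * X.ρ + l) with hδ
  have hδ0 : 0 < δ := by linarith [G.neg]
  have hδμ : δ < 2 * μ := by linarith [G.gt]
  have hup : ∀ k : ℕ, 1 ≤ k → k ≤ n → ∀ m : ℤ, 0 < k * X.ρ + m → δ ≤ k * X.ρ + m := by
    intro k hk hkn m hm
    by_contra! hcon
    have h1 := hfirst (n - k) (by omega) (-m)
    have h2 : X.h (X.F^[n] x) = X.h (X.F^[n - k] x) + k * X.ρ := by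
      rw [X.h_iter, X.h_iter, Nat.cast_sub hkn]; ring
    refine absurd h1 (not_le.2 (abs_lt.2 ⟨?_, ?_⟩)) <;> push_cast <;> linarith
  have hsep : ∀ k : ℕ, 1 ≤ k → k < n → ∀ m : ℤ, δ ≤ |k * X.ρ + m| := by
    intro k hk hkn m
    rcases lt_or_gt_of_ne (mul_add_ne_zero (X := X) hk m) with h | h
    · rw [abs_of_neg h]
      by_contra! hcon
      by_cases hkD : k ≤ D
      · linarith [G.closest k hk hkD m h]
      · have h1 := hup (k - D) (by omega) (by omega) (m - l)
          (by push_cast [Nat.cast_sub (not_le.1 hkD).le]; linarith)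
        push_cast [Nat.cast_sub (not_le.1 hkD).le] at h1
        linarith
    · rw [abs_of_pos h]
      exact hup k hk hkn.le m h
  set y := X.F^[n] x with hy
  have hby : X.b < y := X.lt_of_h_lt (by rwa [X.h_b])
  obtain ⟨z, hz, hzmin⟩ := X.exists_min_preimage D (X.b - l)
  have hhz : X.h z = δ := by
    have h1 := congrArg X.h hz
    have h2 := X.h_add_int X.b (-l)
    push_cast at h2
    rw [← sub_eq_add_neg, X.h_b] at h2
    rw [X.h_iter, h2] at h1
    linarith
  have hyz : y < z := X.lt_of_h_lt (by rwa [hhz])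
  have hza : z ≤ X.a + 1 := by
    refine (X.lt_of_h_lt ?_).le
    rw [X.h_add_one, X.h_a, hhz]
    linarith
  -- the image of `[b, z]` at the critical value
  have hF : X.F y - X.F X.b ≤
      Real.exp (28 * X.C) * (1 / (κ * (X.b - X.a))) * (X.F z - X.F y) := by
    have hit : ∀ u, X.F^[D - 1] (X.F u + l) = X.F^[D] u + l := fun u => by
      rw [X.iter_add_int, ← Function.iterate_succ_apply, Nat.succ_eq_add_one, Nat.sub_add_cancel hD]
    obtain ⟨s₁, hs₁, hmax⟩ := X.exists_max_preimage (D - 1) w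
    have h12 : s₁ < X.F X.a + l :=
      (X.iter_mono (D - 1)).reflect_lt (by rw [hs₁, hit]; exact G.w_lt)
    have h23 : X.F X.a + l < X.F y + l := by
      refine X.lt_of_h_lt ?_
      rw [X.h_add_int, X.h_add_int, X.h_map, X.h_map, X.h_a]
      linarith
    have h34 : X.F y + l < X.F z + l := by
      refine X.lt_of_h_lt ?_
      rw [X.h_add_int, X.h_add_int, X.h_map, X.h_map, hhz]
      linarith
    have hmin : ∀ s', s' < X.F z + l → X.F^[D - 1] s' < X.b := by
      intro s' hs'
      obtain ⟨z', hz', -⟩ := X.exists_max_preimage 1 (s' - l)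
      rw [Function.iterate_one] at hz'
      have h1 : z' < z := X.mono.reflect_lt (by rw [hz']; linarith)
      have h2 := hzmin z' h1
      have h3 := hit z'
      rw [hz', sub_add_cancel] at h3
      linarith
    obtain ⟨-, -, -, hcr⟩ := X.crossRatio_pullback_le (t₁ := w) (t₄ := X.b) hμ
      (fun k hk hkn => G.sep k hk (by omega)) hs₁ hmax
      (by rw [hit, hz]; ring) hmin
      (fun k hk hkn m => G.miss_b hk (by omega) m) (by rw [X.h_b]; linarith [G.h_w])
      h12 h23 h34
    rw [hit, hit] at hcr
    have hres := sub_le_of_crossRatio_le_right (K := Real.exp (28 * X.C) *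
      (1 / (κ * (X.b - X.a)))) h12 h23 h34 (hcr.trans
        (mul_le_mul_of_nonneg_left ?_ (Real.exp_pos _).le))
    · rw [X.F_b]
      linarith
    · have hY : X.F^[D] y + l < X.a := by
        refine X.lt_of_h_lt ?_
        rw [X.h_add_int, X.h_iter, X.h_a]
        linarith
      rw [crossRatio, div_le_div_iff₀ (mul_pos (by linarith) (by linarith))
        (mul_pos hκ (by linarith)), one_mul]
      have h0 : X.F^[D] X.a ≤ X.F^[D] y := X.iter_mono D (by linarith)
      have h1 : κ * (X.F^[D] y + l - (X.F^[D] X.a + l)) ≤ X.F^[D] X.a + l - w := by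
        nlinarith [G.space]
      have h3 : (X.F^[D] y + l - (X.F^[D] X.a + l)) * (X.b - w) ≤
          X.F^[D] y + l - (X.F^[D] X.a + l) :=
        mul_le_of_le_one_right (by linarith) (G.b_sub_w_le hμ')
      calc (X.F^[D] y + l - (X.F^[D] X.a + l)) * (X.b - w) * (κ * (X.b - X.a))
          ≤ (X.F^[D] y + l - (X.F^[D] X.a + l)) * (κ * (X.b - X.a)) :=
            mul_le_mul_of_nonneg_right h3 (mul_nonneg hκ.le (by linarith))
        _ = κ * (X.F^[D] y + l - (X.F^[D] X.a + l)) * (X.b - X.a) := by ring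
        _ ≤ (X.F^[D] X.a + l - w) * (X.b - (X.F^[D] y + l)) :=
          mul_le_mul h1 (by linarith) (by linarith) (by linarith)
  have hyb := hK' y z hby hyz hza hF
  -- pull `(a, b, y, z)` back to `x`
  obtain ⟨s₁, hs₁, hmax⟩ := X.exists_max_preimage n X.a
  obtain ⟨s₂, hs₂, hmin₂⟩ := X.exists_min_preimage n X.b
  obtain ⟨s₄, hs₄, hmin⟩ := X.exists_min_preimage n z
  have h12 : s₁ < s₂ := (X.iter_mono n).reflect_lt (by rw [hs₁, hs₂]; linarith)
  have h23 : s₂ < x := (X.iter_mono n).reflect_lt (by rw [hs₂, ← hy]; linarith)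
  have h34 : x < s₄ := (X.iter_mono n).reflect_lt (by rw [hs₄, ← hy]; linarith)
  obtain ⟨-, -, -, hcr⟩ := X.crossRatio_pullback_le hδ0 hsep hs₁ hmax hs₄ hmin
    (fun k hk hkn m hm => by
      have h1 := X.h_mono hm.le
      rw [X.h_iter_a, X.h_a] at h1
      have h2 := hup k hk hkn m (lt_of_le_of_ne h1 (mul_add_ne_zero hk m).symm)
      refine (X.lt_of_h_lt ?_).le
      rw [hhz, X.h_iter_a]
      refine lt_of_le_of_ne h2 fun heq => ?_
      refine mul_add_ne_zero (X := X) (k := k + D) (by omega) (m + l) ?_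
      push_cast
      linarith)
    (by rw [hhz, X.h_a]; linarith) h12 h23 h34
  rw [← hy, hs₂] at hcr
  refine ⟨s₁, s₂, h12, fun t ht => ⟨hmax t ht.1, hmin₂ t ht.2⟩, h23.le, ?_⟩
  refine sub_le_of_crossRatio_le_left h12 h23 h34 (hcr.trans ?_)
  refine mul_le_mul_of_nonneg_left ?_ (Real.exp_pos _).le
  rw [crossRatio, div_le_div_iff₀ (mul_pos (by linarith) (by linarith)) (by linarith)]
  calc (y - X.b) * (z - X.a) * (X.b - X.a) ≤ (y - X.b) * (X.b - X.a) :=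
        mul_le_mul_of_nonneg_right (mul_le_of_le_one_right (by linarith) (by linarith))
          (by linarith)
    _ ≤ K' * (z - y) * (X.b - X.a) := mul_le_mul_of_nonneg_right hyb (by linarith)
    _ = _ := by ring

end GoodReturn

/-- Points whose orbit avoids the boundary leaves see, at small scales, pullbacks of the flat
interval of definite relative size. -/
theorem exists_forall_goodReturn_exists_gap (X : FlatCircleMap) {κ : ℝ} (hκ : 0 < κ) :
    ∃ K > 0, ∀ μ D l w, 0 < μ → μ ≤ 1 / 8 → X.GoodReturn κ μ D l w → ∀ x,
      (∀ (n : ℕ) (i : ℤ), X.h (X.F^[n] x) + i ≠ 0) →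
      ∃ n : ℕ, (∃ i : ℤ, |X.h (X.F^[n] x) + i| < 2 * μ) ∧ ∃ s s' : ℝ, s < s' ∧
        (∀ t ∈ Set.Ioo s s', ∃ i : ℤ, X.F^[n] t + i ∈ Set.Ioo X.a X.b) ∧
        (x ≤ s ∧ s - x ≤ K * (s' - s) ∨ s' ≤ x ∧ x - s' ≤ K * (s' - s)) := by
  have hab := X.hab
  set K₁ := Real.exp (28 * X.C) * (1 / (κ * (X.b - X.a))) with hK₁
  have hK₁0 : 0 < K₁ := mul_pos (Real.exp_pos _) (one_div_pos.2 (mul_pos hκ (by linarith)))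
  obtain ⟨K', hK', hPL⟩ := X.exists_forall_sub_le_right hK₁0
  set K₂ := Real.exp (28 * X.C) * (K' / (X.b - X.a)) with hK₂
  refine ⟨max K₁ K₂, lt_max_of_lt_left hK₁0, fun μ D l w hμ hμ' G x hx => ?_⟩
  classical
  have hex : ∃ n : ℕ, ∃ i : ℤ, |X.h (X.F^[n] x) + i| < -(D * X.ρ + l) := by
    simp only [X.h_iter]
    exact exists_nat_int_abs_add_lt X.irr _ (by linarith [G.neg])
  obtain ⟨i, hi⟩ := Nat.find_spec hex
  set n := Nat.find hex with hn
  have hfirst : ∀ m < n, ∀ j : ℤ, -(D * X.ρ + l) ≤ |X.h (X.F^[m] (x + i)) + j| := by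
    intro m hm j
    have := Nat.find_min hex hm
    push Not at this
    have := this (i + j)
    rw [X.iter_add_int, X.h_add_int]
    push_cast at this
    rwa [add_assoc]
  have hne := hx n i
  rw [abs_lt] at hi
  refine ⟨n, ⟨i, abs_lt.2 ⟨by linarith [G.gt], by linarith [G.gt]⟩⟩, ?_⟩
  have heq : X.h (X.F^[n] (x + i)) = X.h (X.F^[n] x) + i := by rw [X.iter_add_int, X.h_add_int]
  rw [← heq] at hne hi
  have hmem : ∀ {s s' : ℝ}, (∀ t ∈ Set.Ioo s s', X.F^[n] t ∈ Set.Ioo X.a X.b) →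
      ∀ t ∈ Set.Ioo (s - i) (s' - i), ∃ i : ℤ, X.F^[n] t + i ∈ Set.Ioo X.a X.b := by
    intro s s' h t ht
    refine ⟨i, ?_⟩
    rw [← X.iter_add_int]
    exact h _ ⟨by linarith [ht.1], by linarith [ht.2]⟩
  rcases lt_or_gt_of_ne hne with hneg | hpos
  · obtain ⟨s, s', hs, hss, hle, hle'⟩ := G.exists_gap_of_neg hκ hμ hμ' hneg
      (by linarith [hi.1]) hfirst
    refine ⟨s - i, s' - i, by linarith, hmem hss, Or.inl ⟨by linarith, ?_⟩⟩
    have := mul_le_mul_of_nonneg_right (le_max_left K₁ K₂) (show 0 ≤ s' - s by linarith)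
    rw [sub_sub_sub_cancel_right]
    linarith
  · obtain ⟨s, s', hs, hss, hle, hle'⟩ := G.exists_gap_of_pos hκ hμ hμ' hPL hpos
      hi.2 hfirst
    refine ⟨s - i, s' - i, by linarith, hmem hss, Or.inr ⟨by linarith, ?_⟩⟩
    have := mul_le_mul_of_nonneg_right (le_max_right K₁ K₂) (show 0 ≤ s' - s by linarith)
    rw [sub_sub_sub_cancel_right]
    linarith

end FlatCircleMap

namespace FlatCircleMap

variable (X : FlatCircleMap)

/-- Among the first `q` points of the orbit of the flat interval, `F^[j] a + m` is the right
neighbour of `F^[i] a`, at `h`-distance less than `2 * μ`. -/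
structure Adj (μ : ℝ) (q i j : ℕ) (m : ℤ) : Prop where
  left_lt : i < q
  right_lt : j < q
  pos : i * X.ρ < j * X.ρ + m
  lt : j * X.ρ + m < i * X.ρ + 2 * μ
  le_of_lt : ∀ k < q, ∀ n : ℤ, i * X.ρ < k * X.ρ + n → j * X.ρ + m ≤ k * X.ρ + n

variable {X}

theorem Adj.reflect {μ : ℝ} {q i j : ℕ} {m : ℤ} (A : X.Adj μ q i j m) :
    X.reflect.Adj μ q j i m where
  left_lt := A.right_lt
  right_lt := A.left_lt
  pos := by simp only [FlatCircleMap.reflect]; linarith [A.pos]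
  lt := by simp only [FlatCircleMap.reflect]; linarith [A.lt]
  le_of_lt k hk n hn := by
    simp only [FlatCircleMap.reflect] at hn ⊢
    by_contra! hcon
    have := A.le_of_lt k hk (m - n) (by push_cast; linarith)
    push_cast at this
    linarith

variable (X)

theorem iter_b {n : ℕ} (hn : 1 ≤ n) : X.F^[n] X.b = X.F^[n] X.a :=
  X.iter_flat hn ⟨X.hab.le, le_rfl⟩

theorem h_iter_b (n : ℕ) (l : ℤ) : X.h (X.F^[n] X.b + l) = n * X.ρ + l := by
  rw [X.h_add_int, X.h_iter, X.h_b]; ring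

theorem crossRatio_le_three {V P Q W : ℝ} (hVP : V < P) (hPQ : P < Q) (hQW : Q < W)
    (h1 : Q - P ≤ P - V) (h2 : Q - P ≤ W - Q) : crossRatio V P Q W ≤ 3 := by
  rw [crossRatio, div_le_iff₀ (mul_pos (by linarith) (by linarith))]
  nlinarith [mul_nonneg (show 0 ≤ P - V - (Q - P) by linarith) (show 0 ≤ W - Q by linarith),
    mul_nonneg (show 0 ≤ W - Q - (Q - P) by linarith) (show 0 ≤ P - V by linarith),
    mul_nonneg (show 0 ≤ W - Q - (Q - P) by linarith) (show 0 ≤ Q - P by linarith),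
    mul_nonneg (show 0 ≤ P - V - (Q - P) by linarith) (show 0 ≤ Q - P by linarith)]

theorem exists_forall_goodReturn_of_adj : ∃ κ > 0, ∀ (μ : ℝ) (q v i j u : ℕ) (mv m mu : ℤ),
    0 < μ → μ ≤ 1 / 8 → (∀ k : ℕ, 1 ≤ k → k < q → ∀ n : ℤ, μ ≤ |k * X.ρ + n|) →
    X.Adj μ q v i mv → X.Adj μ q i j m → X.Adj μ q j u mu → j < i →
    X.F^[j] X.a + m - X.F^[i] X.b ≤ X.F^[i] X.a + mv - X.F^[v] X.b →
    X.F^[j] X.a + m - X.F^[i] X.b ≤ X.F^[u] X.a + mu - X.F^[j] X.b →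
    ∃ D l w, X.GoodReturn κ μ D l w := by
  obtain ⟨K, hK, hPL⟩ := X.exists_forall_sub_le_left (K := Real.exp (28 * X.C) * 3) (by positivity)
  refine ⟨min 1 (1 / K), by positivity, fun μ q v i j u mv m mu hμ hμ' hsep Av A Au hji h1 h2 => ?_⟩
  obtain ⟨D, rfl⟩ := Nat.exists_eq_add_of_lt hji
  rw [add_assoc] at *
  set D := D + 1 with hD
  have hD1 : 1 ≤ D := by omega
  have hjD := A.left_lt
  rw [X.iter_b (show 1 ≤ j + D by omega)] at h1 h2
  have p1 := Av.pos
  have p2 := A.pos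
  have p3 := Au.pos
  have b1 := Av.lt
  have b2 := A.lt
  have b3 := Au.lt
  push_cast at p1 p2 b1 b2
  have hP0a : X.F^[D] X.a + (-m : ℤ) < X.a := X.lt_of_h_lt (by
    rw [X.h_iter_a, X.h_a]; push_cast; linarith)
  -- no index `k ≤ i` other than the neighbours lies between them
  have hbetween : ∀ k < q, ∀ n : ℤ, v * X.ρ - mv - m ≤ k * X.ρ + n → k * X.ρ + n < j * X.ρ →
      (k = v ∧ n = -mv - m) ∨ (k = j + D ∧ n = -m) := by
    intro k hk n hn hn'
    rcases hn.lt_or_eq with h | h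
    · right
      have e1 := Av.le_of_lt k hk (n + m + mv) (by push_cast; linarith)
      push_cast at e1
      have e2 : ((j + D : ℕ) : ℝ) * X.ρ + (-m : ℤ) = k * X.ρ + n := by
        push_cast
        refine le_antisymm (by linarith) ?_
        by_contra! hcon
        have e3 := A.le_of_lt k hk (n + m) (by push_cast; linarith)
        push_cast at e3
        linarith
      obtain ⟨rfl, rfl⟩ := X.rotation_inj e2
      exact ⟨rfl, rfl⟩
    · left
      have e : (v : ℝ) * X.ρ + ((-mv - m : ℤ) : ℝ) = k * X.ρ + n := by push_cast; linarith
      obtain ⟨rfl, rfl⟩ := X.rotation_inj e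
      exact ⟨rfl, rfl⟩
  suffices hw : ∃ w, w < X.F^[D] X.a + (-m : ℤ) ∧
      min 1 (1 / K) * (X.a - (X.F^[D] X.a + (-m : ℤ))) ≤ X.F^[D] X.a + (-m : ℤ) - w ∧
      D * X.ρ + (-m : ℤ) - 2 * μ ≤ X.h w ∧
      X.F^[j] w = X.F^[v] X.b + (-mv - m : ℤ) ∧
      ∀ z, w < z → X.F^[j] w < X.F^[j] z by
    obtain ⟨w, w1, w2, w3, w4, w5⟩ := hw
    refine ⟨D, -m, w, hD1, fun k hk hkD => hsep k hk (by omega), by push_cast; linarith,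
      by push_cast; linarith, fun k hk hkD n hn => ?_, w1, w2, w3, fun k hk hkD n hn => ?_⟩
    · push_cast
      by_contra! hcon
      have := A.le_of_lt (j + k) (by omega) (n + m) (by push_cast; linarith)
      push_cast at this
      linarith
    · by_contra! hcon
      have e1 := w5 _ hn
      rw [w4, X.iter_add_int, ← Function.iterate_add_apply] at e1
      have e2 := X.h_mono e1.le
      rw [X.h_iter_b, X.h_iter_a] at e2
      have e3 := X.h_mono hcon.le
      rw [X.h_iter_a, X.h_a] at e3
      have e4 := lt_of_le_of_ne e3 (GoodReturn.mul_add_ne_zero hk n)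
      push_cast at e2
      rcases hbetween (j + k) (by omega) n (by push_cast; linarith) (by push_cast; linarith) with
        ⟨rfl, rfl⟩ | ⟨h, -⟩
      · rw [X.iter_b (by omega)] at e1
        exact lt_irrefl _ e1
      · omega
  set V := X.F^[v] X.b + (-mv - m : ℤ) with hV
  set P := X.F^[j + D] X.a + (-m : ℤ) with hP
  have hVP : V < P := X.lt_of_h_lt (by rw [hV, hP, X.h_iter_b, X.h_iter_a]; push_cast; linarith)
  rcases Nat.eq_zero_or_pos j with rfl | hj
  · simp only [zero_add] at *
    rw [hP] at hVP
    refine ⟨V, hVP, ?_, ?_, rfl, fun z hz => hz⟩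
    · refine (mul_le_of_le_one_left (by linarith) (min_le_left _ _)).trans ?_
      simp only [Function.iterate_zero, id_eq] at h1
      rw [hV]
      push_cast
      linarith
    · rw [hV, X.h_iter_b]
      push_cast
      push_cast at b1
      linarith
  · rw [X.iter_b hj] at h2
    set W := X.F^[u] X.a + mu with hW
    set Q := X.F^[j] X.a with hQ
    have hPQ : P < Q := X.lt_of_h_lt (by
      rw [hP, hQ, X.h_iter_a, X.h_iter, X.h_a]; push_cast; linarith)
    have hQW : Q < W := X.lt_of_h_lt (by
      rw [hW, hQ, X.h_iter_a, X.h_iter, X.h_a]; linarith)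
    obtain ⟨w, hw, hmax⟩ := X.exists_max_preimage j V
    obtain ⟨s₄, hs₄, hmin⟩ := X.exists_min_preimage (j - 1) W
    have hit : ∀ z, X.F^[j - 1] (X.F z) = X.F^[j] z := fun z => by
      rw [← Function.iterate_succ_apply, Nat.succ_eq_add_one, Nat.sub_add_cancel hj]
    set P₀ := X.F^[D] X.a + (-m : ℤ) with hP₀
    have hjP : X.F^[j] P₀ = P := by
      rw [hP₀, hP, X.iter_add_int, ← Function.iterate_add_apply]
    have hwP : w < P₀ := (X.iter_mono j).reflect_lt (by rwa [hw, hjP])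
    have h12 : X.F w < X.F P₀ := (X.iter_mono (j - 1)).reflect_lt (by rwa [hit, hit, hw, hjP])
    have h23 : X.F P₀ < X.F X.a := (X.iter_mono (j - 1)).reflect_lt (by rwa [hit, hit, hjP])
    have h34 : X.F X.a < s₄ := (X.iter_mono (j - 1)).reflect_lt (by rwa [hit, hs₄])
    have hhV : X.h V = v * X.ρ - mv - m := by rw [hV, X.h_iter_b]; push_cast; ring
    have hhw : X.h w = X.h V - j * X.ρ := by rw [← hw, X.h_iter]; ring
    obtain ⟨-, -, -, hcr⟩ := X.crossRatio_pullback_le (t₁ := V) hμ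
      (fun k hk hkn => hsep k hk (by omega)) (by rw [hit, hw])
      (fun z hz => by
        obtain ⟨z', hz', -⟩ := X.exists_max_preimage 1 z
        rw [Function.iterate_one] at hz'
        rw [← hz', hit]
        exact hmax _ (X.mono.reflect_lt (by rwa [hz'])))
      hs₄ hmin
      (fun k hk hkj n hn => by
        have e1 := X.h_mono hn.le
        rw [X.h_iter_a, hhV] at e1
        have e2 : j * X.ρ < k * X.ρ + n := by
          by_contra! hcon
          rcases hcon.lt_or_eq with h | h
          · rcases hbetween k (by omega) n e1 h with ⟨rfl, rfl⟩ | ⟨h, -⟩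
            · rw [hV, X.iter_b hk] at hn
              exact lt_irrefl _ hn
            · omega
          · have := (X.rotation_inj (j := k) (k := j) (l := n) (m := 0) (by simpa using h)).1
            omega
        have e3 := Au.le_of_lt k (by omega) n e2
        rcases e3.lt_or_eq with h | h
        · exact (X.lt_of_h_lt (by rwa [hW, X.h_iter_a, X.h_iter_a])).le
        · obtain ⟨rfl, rfl⟩ := X.rotation_inj h
          exact le_rfl)
      (by rw [hhV, hW, X.h_iter_a]; linarith) h12 h23 h34
    rw [hit, hit, hjP, ← hQ] at hcr
    have hcr' := sub_le_of_crossRatio_le_left h12 h23 h34 (hcr.trans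
      (mul_le_mul_of_nonneg_left (crossRatio_le_three hVP hPQ hQW
        (by rw [hP, hV]; push_cast; linarith) (by rw [hP, hW]; push_cast; linarith))
        (Real.exp_pos _).le))
    have hbw : X.b - 1 ≤ w := by
      refine (X.lt_of_h_lt ?_).le
      have := X.h_add_one (X.b - 1)
      rw [sub_add_cancel, X.h_b] at this
      linarith
    have hle := hPL w P₀ hbw hwP hP0a hcr'
    refine ⟨w, hwP, ?_, ?_, hw, fun z hz => by rw [hw]; exact hmax z hz⟩
    · calc min 1 (1 / K) * (X.a - P₀) ≤ 1 / K * (X.a - P₀) :=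
            mul_le_mul_of_nonneg_right (min_le_right _ _) (by linarith)
        _ ≤ P₀ - w := by rw [one_div, inv_mul_le_iff₀ hK]; exact hle
    · rw [hhw, hhV]
      push_cast
      linarith

end FlatCircleMap

theorem exists_best_approximations {ρ : ℝ} (hρ : Irrational ρ) {μ₀ : ℝ} (hμ₀ : 0 < μ₀) :
    ∃ μ, 0 < μ ∧ μ < μ₀ ∧ ∃ (p q : ℕ) (p' q' : ℤ), 1 ≤ p ∧ p < q ∧
      (∀ k : ℕ, 1 ≤ k → k < q → ∀ n : ℤ, μ ≤ |k * ρ + n|) ∧ |p * ρ + p'| = μ ∧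
      |q * ρ + q'| < μ := by
  classical
  have hdir : ∀ δ : ℝ, 0 < δ → ∃ k : ℕ, 1 ≤ k ∧ |k * ρ - round (k * ρ)| < δ := by
    intro δ hδ
    obtain ⟨N, hN⟩ := exists_nat_gt (1 / δ)
    have hN0 : 0 < N := by
      have : (0 : ℝ) < N := lt_trans (by positivity) hN
      exact_mod_cast this
    obtain ⟨p, q, hq, -, hpq⟩ := Real.exists_int_int_abs_mul_sub_le ρ hN0
    obtain ⟨m, rfl⟩ := Int.eq_ofNat_of_zero_le hq.le
    refine ⟨m, by omega, (round_le _ p).trans_lt ?_⟩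
    push_cast at hpq
    refine hpq.trans_lt ?_
    rw [div_lt_iff₀ (by positivity)]
    rw [div_lt_iff₀ hδ] at hN
    linarith
  obtain ⟨N, hN, hNμ⟩ := hdir μ₀ hμ₀
  obtain ⟨p, hp, hpmin⟩ := Finset.exists_min_image (Finset.Icc 1 N)
    (fun k : ℕ => |k * ρ - round (k * ρ)|) ⟨N, Finset.mem_Icc.2 ⟨hN, le_rfl⟩⟩
  rw [Finset.mem_Icc] at hp
  set μ := |(p : ℝ) * ρ - round (p * ρ)| with hμ
  have hμ0 : 0 < μ := by
    rw [hμ, abs_pos, sub_ne_zero]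
    exact (hρ.natCast_mul (by omega)).ne_int _
  have hex := hdir μ hμ0
  obtain ⟨hq1, hq⟩ := Nat.find_spec hex
  have hqmin : ∀ k : ℕ, 1 ≤ k → k < Nat.find hex → μ ≤ |k * ρ - round (k * ρ)| := by
    intro k hk hkq
    have := Nat.find_min hex hkq
    push Not at this
    exact this hk
  refine ⟨μ, hμ0, (hpmin N (Finset.mem_Icc.2 ⟨hN, le_rfl⟩)).trans_lt hNμ, p, Nat.find hex,
    -round (p * ρ), -round (Nat.find hex * ρ), hp.1, ?_, fun k hk hkq n => ?_, ?_, ?_⟩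
  · by_contra! hle
    exact absurd (hpmin _ (Finset.mem_Icc.2 ⟨hq1, hle.trans hp.2⟩)) (not_le.2 hq)
  · refine (hqmin k hk hkq).trans ((round_le _ (-n)).trans_eq ?_)
    push_cast
    rw [sub_neg_eq_add]
  · push_cast
    rw [← sub_eq_add_neg]
  · push_cast
    rwa [← sub_eq_add_neg]

namespace FlatCircleMap

variable (X : FlatCircleMap)

theorem exists_adj {μ : ℝ} (hμ : μ ≤ 1 / 8) {p q : ℕ} {p' q' : ℤ} (hpq : p < q)
    (hp : |p * X.ρ + p'| = μ) (hq : |q * X.ρ + q'| < μ) {i : ℕ} (hi : i < q) :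
    ∃ j m, X.Adj μ q i j m := by
  have hfr : ∀ (y : ℝ) (n : ℤ), 0 < y + n → Int.fract y ≤ y + n := by
    intro y n hy
    have h1 : (-n : ℤ) ≤ ⌊y⌋ := Int.le_floor.2 (by push_cast; linarith)
    have h2 : (-n : ℝ) ≤ ⌊y⌋ := by exact_mod_cast h1
    rw [Int.fract]
    linarith
  have hclose : ∃ k < q, ∃ n : ℤ, i * X.ρ < k * X.ρ + n ∧ k * X.ρ + n < i * X.ρ + 2 * μ := by
    obtain ⟨hq1, hq2⟩ := abs_lt.1 hq
    rcases le_total 0 ((p : ℝ) * X.ρ + p') with h | h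
    · rw [abs_of_nonneg h] at hp
      by_cases hipq : i + p < q
      · exact ⟨i + p, hipq, p', by push_cast; linarith, by push_cast; linarith⟩
      · refine ⟨i + p - q, by omega, p' - q', ?_, ?_⟩ <;>
          push_cast [Nat.cast_sub (not_lt.1 hipq)] <;> linarith
    · rw [abs_of_nonpos h] at hp
      by_cases hpi : p ≤ i
      · refine ⟨i - p, by omega, -p', ?_, ?_⟩ <;> push_cast [Nat.cast_sub hpi] <;> linarith
      · refine ⟨i + q - p, by omega, q' - p', ?_, ?_⟩ <;>
          push_cast [Nat.cast_sub (show p ≤ i + q by omega)] <;> linarith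
  obtain ⟨k, hk, n, hn, hn'⟩ := hclose
  have hself : ∀ n : ℤ, (i : ℝ) * X.ρ < i * X.ρ + n → (1 : ℝ) ≤ n := by
    intro n hn
    have : (0 : ℝ) < n := by linarith
    have : 0 < n := by exact_mod_cast this
    exact_mod_cast this
  have hki : k ≠ i := by
    rintro rfl
    linarith [hself n hn]
  obtain ⟨j, hj, hjmin⟩ := Finset.exists_min_image ((Finset.range q).erase i)
    (fun k : ℕ => Int.fract (k * X.ρ - i * X.ρ)) ⟨k, by simp [hk, hki]⟩
  simp only [Finset.mem_erase, Finset.mem_range] at hj hjmin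
  have hjf : (j : ℝ) * X.ρ + (-⌊(j : ℝ) * X.ρ - i * X.ρ⌋ : ℤ) =
      i * X.ρ + Int.fract (j * X.ρ - i * X.ρ) := by
    rw [Int.fract]; push_cast; ring
  have hlt : Int.fract ((j : ℝ) * X.ρ - i * X.ρ) < 2 * μ := by
    linarith [hjmin k ⟨hki, hk⟩, hfr (k * X.ρ - i * X.ρ) n (by linarith)]
  refine ⟨j, -⌊(j : ℝ) * X.ρ - i * X.ρ⌋, hi, hj.2, ?_, by rw [hjf]; linarith, fun k' hk' n' hn' => ?_⟩
  · rw [hjf]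
    refine lt_add_of_pos_right _ (lt_of_le_of_ne (Int.fract_nonneg _) fun h => hj.1 ?_)
    rw [← h] at hjf
    exact (X.rotation_inj (l := -⌊(j : ℝ) * X.ρ - i * X.ρ⌋) (m := 0) (by simpa using hjf)).1
  · rw [hjf]
    by_cases h : k' = i
    · subst h
      linarith [hself n' hn']
    · linarith [hjmin k' ⟨h, hk'⟩, hfr (k' * X.ρ - i * X.ρ) n' (by linarith)]

theorem exists_goodReturn : ∃ κ > 0, ∃ κ' > 0, ∀ μ₀ > 0, ∃ μ, 0 < μ ∧ μ < μ₀ ∧ μ ≤ 1 / 8 ∧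
    ((∃ D l w, X.GoodReturn κ μ D l w) ∨ ∃ D l w, X.reflect.GoodReturn κ' μ D l w) := by
  obtain ⟨κ, hκ, hX⟩ := X.exists_forall_goodReturn_of_adj
  obtain ⟨κ', hκ', hX'⟩ := X.reflect.exists_forall_goodReturn_of_adj
  refine ⟨κ, hκ, κ', hκ', fun μ₀ hμ₀ => ?_⟩
  obtain ⟨μ, hμ, hlt, p, q, p', q', -, hpq, hsep, hp, hq⟩ :=
    exists_best_approximations X.irr (lt_min hμ₀ (show (0 : ℝ) < 1 / 8 by norm_num))
  have hμ8 := (hlt.trans_le (min_le_right _ _)).le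
  refine ⟨μ, hμ, hlt.trans_le (min_le_left _ _), hμ8, ?_⟩
  have hadj := fun i (hi : i < q) => X.exists_adj hμ8 hpq hp hq hi
  choose! σ m hA using hadj
  have hinj : Set.InjOn σ (Finset.range q) := by
    intro i hi i' hi' heq
    have key : ∀ i < q, ∀ i' < q, σ i = σ i' → i' * X.ρ ≤ i * X.ρ + (m i' - m i : ℤ) := by
      intro i hi i' hi' heq
      by_contra! hcon
      have := (hA i hi).le_of_lt i' hi' (m i - m i') (by push_cast at hcon ⊢; linarith)
      rw [heq] at this
      have := (hA i' hi').pos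
      push_cast at *
      linarith
    simp only [Finset.coe_range, Set.mem_Iio] at hi hi'
    have h1 := key i hi i' hi' heq
    have h2 := key i' hi' i hi heq.symm
    refine (X.rotation_inj (l := m i' - m i) (m := 0) ?_).1
    push_cast at *
    linarith
  have hsurj := Finset.surjOn_of_injOn_of_card_le (s := Finset.range q) (t := Finset.range q) σ
    (fun i hi => by
      simp only [Finset.coe_range, Set.mem_Iio] at hi ⊢
      exact (hA i hi).right_lt) hinj le_rfl
  obtain ⟨i, hi, hmin⟩ := Finset.exists_min_image (Finset.range q)
    (fun i => X.F^[σ i] X.a + m i - X.F^[i] X.b) ⟨0, by simp; omega⟩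
  obtain ⟨v, hv, hvi⟩ := hsurj hi
  simp only [Finset.coe_range, Set.mem_Iio, Finset.mem_range] at hi hv hmin
  have A := hA i hi
  have Av := hA v hv
  have Au := hA (σ i) A.right_lt
  have h1 := hmin v hv
  have h2 := hmin (σ i) A.right_lt
  rw [hvi] at Av h1
  have hne : σ i ≠ i := by
    intro h
    have h1 := A.pos
    have h2 := A.lt
    rw [h] at h1 h2
    have h3 : (0 : ℝ) < m i := by linarith
    have h4 : 1 ≤ m i := by exact_mod_cast h3
    have : (1 : ℝ) ≤ m i := by exact_mod_cast h4
    linarith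
  rcases lt_or_gt_of_ne hne with h | h
  · exact Or.inl (hX μ q v i (σ i) (σ (σ i)) _ _ _ hμ hμ8 hsep Av A Au h h1 h2)
  · refine Or.inr (hX' μ q (σ (σ i)) (σ i) i v _ _ _ hμ hμ8 (fun k hk hkq n => ?_) Au.reflect
      A.reflect Av.reflect h ?_ ?_)
    · have := hsep k hk hkq (-n)
      rw [← abs_neg] at this
      convert this using 2
      simp only [reflect]
      push_cast
      ring
    · simp only [X.reflect_iter]
      simp only [reflect, neg_neg]
      linarith
    · simp only [X.reflect_iter]
      simp only [reflect, neg_neg]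
      linarith

end FlatCircleMap

/-- A measurable set of reals such that near each of its points, outside a countable set, one
finds arbitrarily small complementary intervals whose distance to the point is comparable to their
length, is a null set. -/
theorem volume_eq_zero_of_porous {E N : Set ℝ} (hE : MeasurableSet E) (hN : N.Countable) {K : ℝ}
    (hK : 0 < K) (h : ∀ x ∈ E, x ∉ N → ∀ ε > 0, ∃ s s', s < s' ∧ s' - s < ε ∧
      Disjoint E (Set.Ioo s s') ∧
      (x ≤ s ∧ s - x ≤ K * (s' - s) ∨ s' ≤ x ∧ x - s' ≤ K * (s' - s))) :
    MeasureTheory.volume E = 0 := by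
  have h1 := Besicovitch.ae_tendsto_measure_inter_div MeasureTheory.volume E
  rw [MeasureTheory.ae_restrict_iff' hE] at h1
  have h2 : ∀ᵐ x : ℝ, x ∉ N := MeasureTheory.measure_eq_zero_iff_ae_notMem.1 (hN.measure_zero _)
  rw [MeasureTheory.measure_eq_zero_iff_ae_notMem]
  filter_upwards [h1, h2] with x hx hxN hxE
  have hc : ENNReal.ofReal (1 - 1 / (2 * (K + 1))) < 1 := by
    rw [ENNReal.ofReal_lt_one]
    have : 0 < 1 / (2 * (K + 1)) := by positivity
    linarith
  have hc0 : 0 ≤ 1 - 1 / (2 * (K + 1)) := by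
    rw [sub_nonneg, div_le_one (by positivity)]; linarith
  have h3 := (hx hxE).eventually (lt_mem_nhds hc)
  rw [eventually_nhdsWithin_iff, Metric.eventually_nhds_iff] at h3
  obtain ⟨ε, hε, h3⟩ := h3
  obtain ⟨s, s', hs, hsε, hd, halt⟩ := h x hxE hxN (ε / (K + 1)) (by positivity)
  rw [lt_div_iff₀ (by positivity)] at hsε
  set r := (s' - s) * (K + 1) with hr
  have hs0 : 0 < s' - s := sub_pos.2 hs
  have hr0 : 0 < r := by positivity
  have h4 := h3 (y := r) (by rw [Real.dist_eq, sub_zero, abs_of_pos hr0]; exact hsε) hr0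
  have hsub : Set.Ioo s s' ⊆ Metric.closedBall x r := by
    intro t ht
    rw [Metric.mem_closedBall, Real.dist_eq, abs_le]
    have := ht.1
    have := ht.2
    rcases halt with ⟨h5, h6⟩ | ⟨h5, h6⟩ <;> constructor <;> nlinarith
  have h5 : MeasureTheory.volume (E ∩ Metric.closedBall x r) + MeasureTheory.volume (Set.Ioo s s') ≤
      MeasureTheory.volume (Metric.closedBall x r) := by
    rw [← MeasureTheory.measure_union (hd.mono_left Set.inter_subset_left) measurableSet_Ioo]
    exact MeasureTheory.measure_mono (Set.union_subset Set.inter_subset_right hsub)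
  have h6 := ENNReal.mul_lt_of_lt_div h4
  rw [Real.volume_closedBall] at h5 h6
  rw [Real.volume_Ioo] at h5
  have h7 := (ENNReal.add_lt_add_right (a := ENNReal.ofReal (s' - s)) ENNReal.ofReal_ne_top h6)
  rw [add_comm, add_comm (ENNReal.ofReal (s' - s))] at h7
  have h8 := h7.trans_le h5
  rw [← ENNReal.ofReal_mul hc0, ← ENNReal.ofReal_add (by positivity) hs0.le,
    ENNReal.ofReal_lt_ofReal_iff (by positivity)] at h8
  have : (1 - 1 / (2 * (K + 1))) * (2 * r) + (s' - s) = 2 * r := by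
    rw [hr]; field_simp; ring
  linarith

namespace FlatCircleMap

variable (X : FlatCircleMap)

theorem exists_forall_exists_gap : ∃ K > 0, ∀ η > 0, ∀ x,
    (∀ (n : ℕ) (i : ℤ), X.h (X.F^[n] x) + i ≠ 0) →
    ∃ n, (∃ i : ℤ, |X.h (X.F^[n] x) + i| < η) ∧ ∃ s s', s < s' ∧
      (∀ t ∈ Set.Ioo s s', ∃ i : ℤ, X.F^[n] t + i ∈ Set.Ioo X.a X.b) ∧
      (x ≤ s ∧ s - x ≤ K * (s' - s) ∨ s' ≤ x ∧ x - s' ≤ K * (s' - s)) := by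
  obtain ⟨κ, hκ, κ', hκ', H⟩ := X.exists_goodReturn
  obtain ⟨K₁, hK₁, H₁⟩ := X.exists_forall_goodReturn_exists_gap hκ
  obtain ⟨K₂, hK₂, H₂⟩ := X.reflect.exists_forall_goodReturn_exists_gap hκ'
  refine ⟨max K₁ K₂, lt_max_of_lt_left hK₁, fun η hη x hx => ?_⟩
  obtain ⟨μ, hμ, hμη, hμ8, ⟨D, l, w, G⟩ | ⟨D, l, w, G⟩⟩ := H (η / 2) (by positivity)
  · obtain ⟨n, ⟨i, hi⟩, s, s', hs, hg, halt⟩ := H₁ μ D l w hμ hμ8 G x hx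
    have := mul_le_mul_of_nonneg_right (le_max_left K₁ K₂) (sub_pos.2 hs).le
    exact ⟨n, ⟨i, by linarith⟩, s, s', hs, hg,
      halt.imp (fun h => ⟨h.1, h.2.trans this⟩) (fun h => ⟨h.1, h.2.trans this⟩)⟩
  · have hr : ∀ n, X.reflect.h (X.reflect.F^[n] (-x)) = -X.h (X.F^[n] x) := by
      intro n
      rw [reflect_iter]
      change -X.h (- -X.F^[n] (- -x)) = _
      rw [neg_neg, neg_neg]
    obtain ⟨n, ⟨i, hi⟩, s, s', hs, hg, halt⟩ := H₂ μ D l w hμ hμ8 G (-x) (fun n i h => by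
      rw [hr] at h
      apply hx n (-i)
      push_cast
      linarith)
    have := mul_le_mul_of_nonneg_right (le_max_right K₁ K₂) (sub_pos.2 hs).le
    refine ⟨n, ⟨-i, ?_⟩, -s', -s, by linarith, fun t ht => ?_, ?_⟩
    · rw [hr, ← abs_neg] at hi
      push_cast
      rw [show -(-X.h (X.F^[n] x) + i) = X.h (X.F^[n] x) + -i by ring] at hi
      linarith
    · obtain ⟨j, hj⟩ := hg (-t) ⟨by linarith [ht.2], by linarith [ht.1]⟩
      rw [reflect_iter, neg_neg] at hj
      have h1 : -X.b < -X.F^[n] t + j := hj.1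
      have h2 : -X.F^[n] t + j < -X.a := hj.2
      exact ⟨-j, by push_cast; linarith, by push_cast; linarith⟩
    · rcases halt with h | h
      · exact Or.inr ⟨by linarith, by linarith⟩
      · exact Or.inl ⟨by linarith, by linarith⟩

theorem measurableSet_iter_mem (n : ℕ) :
    MeasurableSet {t | ∃ i : ℤ, X.F^[n] t + i ∈ Set.Ioo X.a X.b} := by
  rw [Set.ofPred_exists]
  exact MeasurableSet.iUnion fun i =>
    ((X.iter_cont n).add continuous_const).measurable measurableSet_Ioo

theorem h_iter_eq_of_mem {n : ℕ} {t : ℝ} {i : ℤ} (h : X.F^[n] t + i ∈ Set.Icc X.a X.b) :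
    X.h t + n * X.ρ + i = 0 := by
  rw [← X.h_iter, ← X.h_add_int, X.h_eq_zero h]

theorem gap_length_le_one {n : ℕ} {s s' : ℝ}
    (hg : ∀ t ∈ Set.Ioo s s', ∃ i : ℤ, X.F^[n] t + i ∈ Set.Ioo X.a X.b) : s' - s ≤ 1 := by
  by_contra! hlt
  obtain ⟨s₀, hs₀, -⟩ := X.exists_max_preimage n X.b
  obtain ⟨i, hi⟩ := hg (s₀ + (⌊s - s₀⌋ + 1 : ℤ)) ⟨by
    push_cast; linarith [Int.lt_floor_add_one (s - s₀)], by
    push_cast; linarith [Int.floor_le (s - s₀)]⟩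
  rw [X.iter_add_int, hs₀, add_assoc, ← Int.cast_add] at hi
  generalize ⌊s - s₀⌋ + 1 + i = j at hi
  have hj : j < 0 := by
    have : (j : ℝ) < 0 := by linarith [hi.2]
    exact_mod_cast this
  have : (j : ℝ) ≤ -1 := by exact_mod_cast (by omega : j ≤ -1)
  linarith [hi.1, X.hba]

theorem exists_forall_exists_small_gap : ∃ K > 0, ∀ x,
    (∀ (n : ℕ) (i : ℤ), X.h (X.F^[n] x) + i ≠ 0) → ∀ ε > 0,
    ∃ n s s', s < s' ∧ s' - s < ε ∧
      (∀ t ∈ Set.Ioo s s', ∃ i : ℤ, X.F^[n] t + i ∈ Set.Ioo X.a X.b) ∧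
      (x ≤ s ∧ s - x ≤ K * (s' - s) ∨ s' ≤ x ∧ x - s' ≤ K * (s' - s)) := by
  obtain ⟨K, hK, H⟩ := X.exists_forall_exists_gap
  refine ⟨K, hK, fun x hx ε hε => ?_⟩
  let A : ℕ → Set ℝ := fun n => {t | ∃ i : ℤ, X.F^[n] t + i ∈ Set.Ioo X.a X.b} ∩
    Set.Icc (x - K - 1) (x + K + 1)
  have hfin : {n | ENNReal.ofReal ε ≤ MeasureTheory.volume (A n)}.Finite := by
    apply MeasureTheory.Measure.finite_const_le_meas_of_disjoint_iUnion
    · simpa using hε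
    · exact fun n => (X.measurableSet_iter_mem n).inter measurableSet_Icc
    · intro n m hnm
      rw [Function.onFun, Set.disjoint_left]
      rintro t ⟨⟨i, hi⟩, -⟩ ⟨⟨j, hj⟩, -⟩
      have h1 := X.h_iter_eq_of_mem (Set.Ioo_subset_Icc_self hi)
      have h2 := X.h_iter_eq_of_mem (Set.Ioo_subset_Icc_self hj)
      exact hnm (X.rotation_inj (l := i) (m := j) (by linarith)).1
    · refine ((MeasureTheory.measure_mono (Set.iUnion_subset fun n => Set.inter_subset_right)).trans_lt
        (?_ : MeasureTheory.volume (Set.Icc (x - K - 1) (x + K + 1)) < ⊤)).ne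
      simp
  have hev : ∀ᶠ η in nhdsWithin (0 : ℝ) (Set.Ioi 0),
      ∀ n ∈ {n | ENNReal.ofReal ε ≤ MeasureTheory.volume (A n)},
      η < |X.h (X.F^[n] x) - round (X.h (X.F^[n] x))| := by
    rw [eventually_all_finite hfin]
    intro n _
    refine nhdsWithin_le_nhds (gt_mem_nhds (abs_pos.2 fun h0 => ?_))
    apply hx n (-round (X.h (X.F^[n] x)))
    push_cast
    linarith
  obtain ⟨η, hη, hη0⟩ := (hev.and self_mem_nhdsWithin).exists
  obtain ⟨n, ⟨i, hi⟩, s, s', hs, hg, halt⟩ := H η hη0 x hx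
  have hlen := X.gap_length_le_one hg
  refine ⟨n, s, s', hs, ?_, hg, halt⟩
  by_contra! hle
  have hsub : Set.Ioo s s' ⊆ A n := by
    refine fun t ht => ⟨hg t ht, ?_⟩
    have := ht.1
    have := ht.2
    rcases halt with h | h <;> constructor <;> nlinarith
  have h1 := hη n (show ENNReal.ofReal ε ≤ MeasureTheory.volume (A n) by
    refine le_trans ?_ (MeasureTheory.measure_mono hsub)
    rw [Real.volume_Ioo]
    exact ENNReal.ofReal_le_ofReal hle)
  have h2 := round_le (X.h (X.F^[n] x)) (-i)
  push_cast at h2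
  rw [sub_neg_eq_add] at h2
  linarith

theorem le_of_h_eq_zero {x : ℝ} (hx : X.h x = 0) : X.a ≤ x := by
  by_contra! hlt
  have hbx : X.b < x + 1 := X.lt_of_h_lt (by rw [X.h_b, X.h_add_one, hx]; norm_num)
  have hF : X.F x < X.F X.a := by
    have := X.strictMonoOn ⟨hbx.le, by linarith⟩ ⟨X.hba.le, le_rfl⟩
      (show x + 1 < X.a + 1 by linarith)
    rw [X.map_add_one, X.map_add_one] at this
    linarith
  have hh : ∀ u ∈ Set.Icc (X.F x) (X.F X.a), X.h u = X.ρ := by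
    intro u hu
    have h1 := X.h_mono hu.1
    have h2 := X.h_mono hu.2
    rw [X.h_map, hx] at h1
    rw [X.h_map, X.h_a] at h2
    linarith
  obtain ⟨K, hK, H⟩ := X.exists_forall_exists_small_gap
  set d := X.F X.a - X.F x with hd
  have hd0 : 0 < d := sub_pos.2 hF
  obtain ⟨n, s, s', hs, hsε, hg, halt⟩ := H (X.F x + d / 2) (fun n i h => by
    rw [X.h_iter, hh _ ⟨by linarith, by linarith⟩] at h
    apply GoodReturn.mul_add_ne_zero (X := X) (k := n + 1) (by omega) i
    push_cast
    linarith) (d / 2 / (K + 1)) (by positivity)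
  rw [lt_div_iff₀ (by positivity)] at hsε
  obtain ⟨i, hi⟩ := hg ((s + s') / 2) ⟨by linarith, by linarith⟩
  have h1 := X.h_iter_eq_of_mem (Set.Ioo_subset_Icc_self hi)
  rw [hh ((s + s') / 2)] at h1
  · apply GoodReturn.mul_add_ne_zero (X := X) (k := n + 1) (by omega) i
    push_cast
    linarith
  · rcases halt with h | h <;> constructor <;> nlinarith

theorem mem_Icc_of_h_eq_zero {x : ℝ} (hx : X.h x = 0) : x ∈ Set.Icc X.a X.b := by
  refine ⟨X.le_of_h_eq_zero hx, ?_⟩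
  have := X.reflect.le_of_h_eq_zero (x := -x) (by
    change -X.h (- -x) = 0
    rw [neg_neg, hx, neg_zero])
  change -X.b ≤ -x at this
  linarith

theorem h_add_int_eq_zero_of_map_eq {u u' : ℝ} (huu : u < u') (h : X.F u = X.F u') :
    ∃ i : ℤ, X.h u + i = 0 := by
  set l := ⌊u - X.b⌋ with hl
  have h1 := Int.floor_le (u - X.b)
  have h2 := Int.lt_floor_add_one (u - X.b)
  rw [← hl] at h1 h2
  rcases lt_or_ge (u + (-l : ℤ)) (X.a + 1) with h3 | h3
  · exfalso
    have h4 : u + (-l : ℤ) < min (u' + (-l : ℤ)) (X.a + 1) := lt_min (by linarith) h3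
    push_cast at h4
    have h5 := X.strictMonoOn ⟨by push_cast; linarith, h3.le⟩
      ⟨by linarith [h4], min_le_right _ _⟩ (by push_cast; exact h4)
    have h6 := X.mono (min_le_left (u' + -(l : ℝ)) (X.a + 1))
    have h7 := X.map_add_int u (-l)
    have h8 := X.map_add_int u' (-l)
    push_cast at h5 h6 h7 h8
    linarith
  · refine ⟨-l - 1, ?_⟩
    rw [← X.h_add_int]
    push_cast at h3 ⊢
    exact X.h_eq_zero ⟨by linarith, by linarith⟩

theorem exists_h_iter_eq_zero_of_iter_eq (n : ℕ) {t t' : ℝ} (htt : t < t')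
    (h : X.F^[n] t = X.F^[n] t') : ∃ k < n, ∃ i : ℤ, X.h t + k * X.ρ + i = 0 := by
  induction n with
  | zero => exact absurd h htt.ne
  | succ n ih =>
    rcases ((X.iter_mono n) htt.le).eq_or_lt with h1 | h1
    · obtain ⟨k, hk, hi⟩ := ih h1
      exact ⟨k, by omega, hi⟩
    · rw [Function.iterate_succ_apply', Function.iterate_succ_apply'] at h
      obtain ⟨i, hi⟩ := X.h_add_int_eq_zero_of_map_eq h1 h
      rw [X.h_iter] at hi
      exact ⟨n, by omega, i, hi⟩

theorem subsingleton_iter_fiber (n : ℕ) (i : ℤ) {c : ℝ} (hc : X.h c = 0) :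
    {t | X.F^[n] t + i = c}.Subsingleton := by
  have key : ∀ t t', X.F^[n] t + i = c → X.F^[n] t' + i = c → ¬ t < t' := by
    intro t t' ht ht' hlt
    obtain ⟨k, hk, j, hj⟩ := X.exists_h_iter_eq_zero_of_iter_eq n hlt (by linarith)
    rw [← ht, X.h_add_int, X.h_iter] at hc
    have := (X.rotation_inj (j := k) (k := n) (l := j) (m := i) (by linarith)).1
    omega
  intro t ht t' ht'
  exact le_antisymm (not_lt.1 (key _ _ ht' ht)) (not_lt.1 fun h => key _ _ ht ht' h)

/-- The points of the line whose orbit never meets the integer translates of the open flat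
interval form a null set. -/
theorem volume_nonwandering_eq_zero :
    MeasureTheory.volume {t | ∀ (n : ℕ) (i : ℤ), X.F^[n] t + i ∉ Set.Ioo X.a X.b} = 0 := by
  obtain ⟨K, hK, H⟩ := X.exists_forall_exists_small_gap
  set E := {t | ∀ (n : ℕ) (i : ℤ), X.F^[n] t + i ∉ Set.Ioo X.a X.b} with hE
  refine volume_eq_zero_of_porous (E := E)
    (N := ⋃ n : ℕ, ⋃ i : ℤ, {t | X.F^[n] t + i = X.a} ∪ {t | X.F^[n] t + i = X.b}) ?_ ?_ hK ?_
  · have : E = (⋃ n : ℕ, {t | ∃ i : ℤ, X.F^[n] t + i ∈ Set.Ioo X.a X.b})ᶜ := by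
      ext t; simp [hE]
    rw [this]
    exact (MeasurableSet.iUnion X.measurableSet_iter_mem).compl
  · exact Set.countable_iUnion fun n => Set.countable_iUnion fun i =>
      (X.subsingleton_iter_fiber n i X.h_a).countable.union
        (X.subsingleton_iter_fiber n i X.h_b).countable
  · intro x hx hxN ε hε
    obtain ⟨n, s, s', hs, hsε, hg, halt⟩ := H x (fun n i h => by
      rw [← X.h_add_int] at h
      have h1 := X.mem_Icc_of_h_eq_zero h
      have h2 := hx n i
      apply hxN
      simp only [Set.mem_iUnion]
      refine ⟨n, i, ?_⟩
      rcases h1.1.eq_or_lt with h3 | h3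
      · exact Or.inl h3.symm
      · exact Or.inr (h1.2.eq_or_lt.resolve_right fun h4 => h2 ⟨h3, h4⟩)) ε hε
    refine ⟨s, s', hs, hsε, ?_, halt⟩
    rw [Set.disjoint_left]
    intro t ht hts
    obtain ⟨i, hi⟩ := hg t hts
    exact ht n i hi

end FlatCircleMap

/-- A monotone degree-one map of the line with translation number `ρ` is monotonically
semiconjugate to the translation by `ρ`. -/
theorem exists_monotone_semiconj {F : ℝ → ℝ} (hF : Monotone F) (hF1 : ∀ x, F (x + 1) = F x + 1)
    {ρ : ℝ} (hlim : Tendsto (fun n : ℕ => F^[n] 0 / n) atTop (nhds ρ)) :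
    ∃ h : ℝ → ℝ, Monotone h ∧ (∀ x, h (x + 1) = h x + 1) ∧ ∀ x, h (F x) = h x + ρ := by
  let f : CircleDeg1Lift := ⟨⟨F, hF⟩, hF1⟩
  have hτ : f.translationNumber = ρ := f.translationNumber_eq_of_tendsto₀ hlim
  have hpow : ∀ (n : ℕ) (x : ℝ), (f ^ n) x = F^[n] x := by
    intro n x
    rw [CircleDeg1Lift.coe_pow]
    rfl
  have hbd : ∀ (n : ℕ) (x : ℝ), |F^[n] x - n * ρ| ≤ |x| + 2 := by
    intro n x
    have h0 := f.dist_pow_map_zero_mul_translationNumber_le n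
    rw [hτ, Real.dist_eq, hpow, abs_le] at h0
    have h1 : F^[n] x ≤ F^[n] 0 + ⌈|x|⌉ := by
      rw [← hpow, ← hpow, ← (f ^ n).map_add_int, zero_add]
      exact (f ^ n).mono ((le_abs_self x).trans (Int.le_ceil _))
    have h2 : F^[n] 0 - ⌈|x|⌉ ≤ F^[n] x := by
      rw [← hpow, ← hpow, ← (f ^ n).map_sub_int, zero_sub]
      exact (f ^ n).mono (by linarith [neg_abs_le x, Int.le_ceil |x|])
    have h3 := Int.ceil_lt_add_one |x|
    rw [abs_le]
    constructor <;> linarith [h0.1, h0.2]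
  let u : ℝ → ℕ → ℝ := fun x n => F^[n] x - n * ρ
  have hle : ∀ x, IsBoundedUnder (· ≤ ·) atTop (u x) := fun x =>
    isBoundedUnder_of ⟨|x| + 2, fun n => (abs_le.1 (hbd n x)).2⟩
  have hge : ∀ x, IsCoboundedUnder (· ≤ ·) atTop (u x) := fun x =>
    (isBoundedUnder_of ⟨-(|x| + 2), fun n => (abs_le.1 (hbd n x)).1⟩ :
      IsBoundedUnder (· ≥ ·) atTop (u x)).isCoboundedUnder_le
  refine ⟨fun x => limsup (u x) atTop, fun x y hxy => ?_, fun x => ?_, fun x => ?_⟩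
  · exact limsup_le_limsup (Eventually.of_forall fun n => sub_le_sub_right (hF.iterate n hxy) _)
      (hge x) (hle y)
  · change limsup (u (x + 1)) atTop = limsup (u x) atTop + 1
    rw [← limsup_add_const atTop (u x) 1 (hle x) (hge x)]
    congr 1
    funext n
    have := (f ^ n).map_add_one x
    rw [hpow, hpow] at this
    simp only [u, this]
    ring
  · change limsup (u (F x)) atTop = limsup (u x) atTop + ρ
    rw [← limsup_nat_add (u x) 1, ← limsup_add_const atTop (fun n => u x (n + 1)) ρ
      ((isBoundedUnder_of ⟨|x| + 2, fun n => (abs_le.1 (hbd (n + 1) x)).2⟩))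
      ((isBoundedUnder_of ⟨-(|x| + 2), fun n => (abs_le.1 (hbd (n + 1) x)).1⟩ :
      IsBoundedUnder (· ≥ ·) atTop (fun n => u x (n + 1))).isCoboundedUnder_le)]
    congr 1
    funext n
    simp only [u, Function.iterate_succ_apply]
    push_cast
    ring

/-- A function on a bounded open interval which agrees near each point of the closed interval with
a `C¹` function is Lipschitz. -/
theorem exists_lipschitz_of_locally_eq_contDiffAt {g : ℝ → ℝ} {p q : ℝ}
    (h : ∀ x ∈ Set.Icc p q, ∃ G : ℝ → ℝ, ContDiffAt ℝ 1 G x ∧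
      ∀ᶠ y in nhds x, y ∈ Set.Ioo p q → g y = G y) :
    ∃ C, 0 ≤ C ∧ ∀ x ∈ Set.Ioo p q, ∀ y ∈ Set.Ioo p q, |g x - g y| ≤ C * |x - y| := by
  have key : ∃ C, ∀ y ∈ Set.Icc p q, y ∈ Set.Ioo p q → |deriv g y| ≤ C := by
    refine isCompact_Icc.induction_on
      (p := fun s => ∃ C, ∀ y ∈ s, y ∈ Set.Ioo p q → |deriv g y| ≤ C) ?_ ?_ ?_ ?_
    · simp
    · rintro s t hst ⟨C, hC⟩
      exact ⟨C, fun y hy => hC y (hst hy)⟩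
    · rintro s t ⟨C, hC⟩ ⟨D, hD⟩
      refine ⟨max C D, fun y hy hyI => hy.elim (fun hy => ?_) fun hy => ?_⟩
      · exact (hC y hy hyI).trans (le_max_left _ _)
      · exact (hD y hy hyI).trans (le_max_right _ _)
    · intro x hx
      obtain ⟨G, hG, hgG⟩ := h x hx
      have hc : ContinuousAt (deriv G) x := by
        simpa [fderiv_apply_one_eq_deriv] using
          (hG.continuousAt_fderiv one_ne_zero).clm_apply (continuousAt_const (y := (1 : ℝ)))
      have hb := hc.abs.eventually (gt_mem_nhds (lt_add_one |deriv G x|))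
      refine ⟨_, mem_nhdsWithin_of_mem_nhds (hb.and hgG.eventually_nhds),
        |deriv G x| + 1, fun y hy hyI => ?_⟩
      have : g =ᶠ[nhds y] G := by
        filter_upwards [hy.2, isOpen_Ioo.mem_nhds hyI] with z hz hzI using hz hzI
      rw [this.deriv_eq]
      exact hy.1.le
  obtain ⟨C, hC⟩ := key
  refine ⟨max C 0, le_max_right _ _, fun x hx y hy => ?_⟩
  refine Convex.norm_image_sub_le_of_norm_deriv_le (𝕜 := ℝ) (f := g) (s := Set.Ioo p q) (fun z hz => ?_)
    (fun z hz => (hC z (Set.Ioo_subset_Icc_self hz) hz).trans (le_max_left _ _))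
    (convex_Ioo p q) hy hx
  obtain ⟨G, hG, hgG⟩ := h z (Set.Ioo_subset_Icc_self hz)
  have : g =ᶠ[nhds z] G := by
    filter_upwards [hgG, isOpen_Ioo.mem_nhds hz] with w hw hwI using hw hwI
  exact this.differentiableAt_iff.2 (hG.differentiableAt one_ne_zero)

theorem contDiffAt_log_deriv_rpow {ψ : ℝ → ℝ} (hψ : ContDiff ℝ (⊤ : ℕ∞) ψ) (h0 : 0 < deriv ψ 0)
    {ℓ : ℝ} (hℓ : 1 < ℓ) : ContDiffAt ℝ 1 (fun t : ℝ => Real.log (deriv ψ (t ^ ℓ))) 0 := by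
  have h1 : ContDiff ℝ 1 (deriv ψ) := by
    have : ContDiff ℝ (1 + 1) ψ := by simpa [one_add_one_eq_two] using contDiff_infty.1 hψ 2
    exact (contDiff_succ_iff_deriv.1 this).2.2
  have h2 : ContDiffAt ℝ 1 (fun t : ℝ => t ^ ℓ) 0 := by
    have := Real.contDiffAt_rpow_const_of_le (x := 0) (p := ℓ) (n := 1) (by simpa using hℓ.le)
    simpa using this
  refine ContDiffAt.log (h1.contDiffAt.comp (0 : ℝ) h2) ?_
  rw [Real.zero_rpow (by linarith)]
  exact h0.ne'

namespace CherryMap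

variable {ℓ : ℝ} (X : CherryMap ℓ)

theorem F_b : X.F X.b = X.F X.a := X.flat _ ⟨X.hab.le, le_rfl⟩

theorem F_eq_near_b {y : ℝ} (h1 : X.b ≤ y) (h2 : y < X.b + X.ε) :
    X.F y = X.F X.b + X.ψb ((y - X.b) ^ ℓ) := by
  have := X.local_b (y - X.b) ⟨by linarith, by linarith⟩
  rwa [add_sub_cancel] at this

theorem F_eq_near_a {y : ℝ} (h1 : X.a + 1 - X.ε < y) (h2 : y ≤ X.a + 1) :
    X.F y = X.F X.a + 1 - X.ψa ((X.a + 1 - y) ^ ℓ) := by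
  have := X.local_a (X.a + 1 - y) ⟨by linarith, by linarith⟩
  have h3 := X.degree_one (y - 1)
  rw [sub_add_cancel] at h3
  rw [show X.a - (X.a + 1 - y) = y - 1 by ring] at this
  linarith

theorem contDiffAt {y : ℝ} (hy : y ∈ Set.Ioo X.b (X.a + 1)) : ContDiffAt ℝ 2 X.F y := by
  have := X.smooth.contDiffAt (isOpen_Ioo.mem_nhds hy)
  exact contDiffAt_infty.1 this 2

theorem continuousAt_add_int {x : ℝ} (h : ContinuousAt X.F x) (k : ℤ) :
    ContinuousAt X.F (x + k) := by
  have h1 : X.F = fun y => X.F (y - k) + k := by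
    funext y
    have := map_add_int_of_map_add_one X.degree_one (y - k) k
    rw [sub_add_cancel] at this
    exact this
  rw [h1]
  refine ContinuousAt.add ?_ continuousAt_const
  refine ContinuousAt.comp (g := X.F) ?_ (by fun_prop)
  simpa using h

theorem continuous_F (hℓ : 1 < ℓ) : Continuous X.F := by
  have hab := X.hab
  have hba := X.hba
  have hε := X.εpos
  have hb : ContinuousAt X.F X.b := by
    rw [continuousAt_iff_continuous_left_right]
    constructor
    · refine (continuousWithinAt_const (b := X.F X.a)).congr_of_eventuallyEq ?_ X.F_b
      filter_upwards [inter_mem_nhdsWithin _ (Ioi_mem_nhds hab)] with y hy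
      exact X.flat y ⟨(le_of_lt hy.2), hy.1⟩
    · refine ContinuousWithinAt.congr_of_eventuallyEq
        (f := fun y => X.F X.b + X.ψb ((y - X.b) ^ ℓ)) (Continuous.continuousWithinAt ?_) ?_ ?_
      · have := X.ψb_smooth.continuous
        exact continuous_const.add (this.comp ((continuous_id.sub continuous_const).rpow_const
          fun _ => Or.inr (by linarith)))
      · filter_upwards [inter_mem_nhdsWithin _ (Iio_mem_nhds (show X.b < X.b + X.ε by linarith))]
          with y hy
        exact X.F_eq_near_b hy.1 hy.2
      · exact X.F_eq_near_b le_rfl (by linarith)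
  have ha : ContinuousAt X.F (X.a + 1) := by
    rw [continuousAt_iff_continuous_left_right]
    constructor
    · refine ContinuousWithinAt.congr_of_eventuallyEq
        (f := fun y => X.F X.a + 1 - X.ψa ((X.a + 1 - y) ^ ℓ))
        (Continuous.continuousWithinAt ?_) ?_ ?_
      · have := X.ψa_smooth.continuous
        exact continuous_const.sub (this.comp ((continuous_const.sub continuous_id).rpow_const
          fun _ => Or.inr (by linarith)))
      · filter_upwards [inter_mem_nhdsWithin _
          (Ioi_mem_nhds (show X.a + 1 - X.ε < X.a + 1 by linarith))] with y hy
        exact X.F_eq_near_a hy.2 hy.1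
      · exact X.F_eq_near_a (by linarith) le_rfl
    · refine (continuousWithinAt_const (b := X.F X.a + 1)).congr_of_eventuallyEq ?_
        (X.degree_one _)
      filter_upwards [inter_mem_nhdsWithin _ (Iio_mem_nhds (show X.a + 1 < X.b + 1 by linarith))]
        with y hy
      have h1 := X.flat (y - 1) ⟨by linarith [show X.a + 1 ≤ y from hy.1],
        by linarith [show y < X.b + 1 from hy.2]⟩
      have h2 := X.degree_one (y - 1)
      rw [sub_add_cancel] at h2
      rw [h2, h1]
  have key : ∀ y ∈ Set.Ioc X.a (X.a + 1), ContinuousAt X.F y := by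
    intro y hy
    rcases lt_trichotomy y X.b with h | h | h
    · refine (continuousAt_const (y := X.F X.a)).congr ?_
      filter_upwards [isOpen_Ioo.mem_nhds (⟨hy.1, h⟩ : y ∈ Set.Ioo X.a X.b)] with z hz
      exact (X.flat z (Set.Ioo_subset_Icc_self hz)).symm
    · rwa [h]
    · rcases hy.2.eq_or_lt with h' | h'
      · rwa [h']
      · exact (X.contDiffAt ⟨h, h'⟩).continuousAt
  rw [continuous_iff_continuousAt]
  intro x
  obtain ⟨k, hk, -⟩ := existsUnique_add_zsmul_mem_Ioc (one_pos : (0 : ℝ) < 1) x X.a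
  have := X.continuousAt_add_int (key _ hk) (-k)
  simpa using this

theorem deriv_eq_near_b (hℓ : 1 < ℓ) {y : ℝ} (h1 : X.b < y) (h2 : y < X.b + X.ε) :
    deriv X.F y = deriv X.ψb ((y - X.b) ^ ℓ) * (ℓ * (y - X.b) ^ (ℓ - 1)) := by
  have h3 : X.F =ᶠ[nhds y] fun y => X.F X.b + X.ψb ((y - X.b) ^ ℓ) := by
    filter_upwards [isOpen_Ioo.mem_nhds (⟨h1, h2⟩ : y ∈ Set.Ioo X.b (X.b + X.ε))] with z hz
    exact X.F_eq_near_b hz.1.le hz.2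
  rw [h3.deriv_eq]
  have h4 := (X.ψb_smooth.differentiable (by simp) ((y - X.b) ^ ℓ)).hasDerivAt
  have h5 : HasDerivAt (fun y => (y - X.b) ^ ℓ) (1 * ℓ * (y - X.b) ^ (ℓ - 1)) y :=
    ((hasDerivAt_id y).sub_const X.b).rpow_const (Or.inr hℓ.le)
  refine ((h4.comp y h5).const_add (X.F X.b)).deriv.trans ?_
  rw [one_mul]

theorem deriv_eq_near_a (hℓ : 1 < ℓ) {y : ℝ} (h1 : X.a + 1 - X.ε < y) (h2 : y < X.a + 1) :
    deriv X.F y = deriv X.ψa ((X.a + 1 - y) ^ ℓ) * (ℓ * (X.a + 1 - y) ^ (ℓ - 1)) := by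
  have h3 : X.F =ᶠ[nhds y] fun y => X.F X.a + 1 - X.ψa ((X.a + 1 - y) ^ ℓ) := by
    filter_upwards [isOpen_Ioo.mem_nhds (⟨h1, h2⟩ : y ∈ Set.Ioo (X.a + 1 - X.ε) (X.a + 1))]
      with z hz
    exact X.F_eq_near_a hz.1 hz.2.le
  rw [h3.deriv_eq]
  have h4 := (X.ψa_smooth.differentiable (by simp) ((X.a + 1 - y) ^ ℓ)).hasDerivAt
  have h5 : HasDerivAt (fun y => (X.a + 1 - y) ^ ℓ) (-1 * ℓ * (X.a + 1 - y) ^ (ℓ - 1)) y :=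
    ((hasDerivAt_id y).const_sub (X.a + 1)).rpow_const (Or.inr hℓ.le)
  refine ((h4.comp y h5).const_sub (X.F X.a + 1)).deriv.trans ?_
  ring

/-- The logarithm of the derivative off the flat arc, with the power-law singularities at the two
endpoints removed. -/
noncomputable def logDistortion (t : ℝ) : ℝ :=
  Real.log (deriv X.F t) - (ℓ - 1) * (Real.log (t - X.b) + Real.log (X.a + 1 - t))

theorem exp_logDistortion {t : ℝ} (ht : t ∈ Set.Ioo X.b (X.a + 1)) :
    Real.exp (X.logDistortion t) * ((t - X.b) ^ (ℓ - 1) * (X.a + 1 - t) ^ (ℓ - 1)) =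
      deriv X.F t := by
  have h1 := sub_pos.2 ht.1
  have h2 := sub_pos.2 ht.2
  rw [Real.rpow_def_of_pos h1, Real.rpow_def_of_pos h2, ← Real.exp_add, ← Real.exp_add,
    logDistortion]
  convert Real.exp_log (X.deriv_pos t ht) using 2
  ring

theorem exists_lipschitz_logDistortion (hℓ : 1 < ℓ) : ∃ C, 0 ≤ C ∧
    ∀ x ∈ Set.Ioo X.b (X.a + 1), ∀ y ∈ Set.Ioo X.b (X.a + 1),
      |X.logDistortion x - X.logDistortion y| ≤ C * |x - y| := by
  have hba := X.hba
  have hε := X.εpos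
  have hlog_b : ∀ x, x ≠ X.b → ContDiffAt ℝ 1 (fun y => Real.log (y - X.b)) x := fun x hx =>
    (contDiffAt_id.sub contDiffAt_const).log (sub_ne_zero.2 hx)
  have hlog_a : ∀ x, x ≠ X.a + 1 → ContDiffAt ℝ 1 (fun y => Real.log (X.a + 1 - y)) x :=
    fun x hx => (contDiffAt_const.sub contDiffAt_id).log (sub_ne_zero.2 hx.symm)
  apply exists_lipschitz_of_locally_eq_contDiffAt
  intro x hx
  rcases hx.1.eq_or_lt with h1 | h1
  · subst h1
    have hψ : ContDiffAt ℝ 1 (fun y => Real.log (deriv X.ψb ((y - X.b) ^ ℓ))) X.b := by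
      have := contDiffAt_log_deriv_rpow X.ψb_smooth X.ψb_deriv_pos hℓ
      refine ContDiffAt.comp (g := fun t : ℝ => Real.log (deriv X.ψb (t ^ ℓ)))
        (f := fun y => y - X.b) X.b ?_ (by fun_prop)
      rwa [sub_self]
    refine ⟨fun y => Real.log (deriv X.ψb ((y - X.b) ^ ℓ)) + Real.log ℓ -
      (ℓ - 1) * Real.log (X.a + 1 - y),
      (hψ.add contDiffAt_const).sub (contDiffAt_const.mul (hlog_a _ hba.ne)), ?_⟩
    filter_upwards [Iio_mem_nhds (show X.b < X.b + X.ε by linarith)] with y hy hyI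
    have hd := X.deriv_pos y hyI
    have h2 := sub_pos.2 hyI.1
    have h3 := Real.rpow_pos_of_pos h2 (ℓ - 1)
    rw [X.deriv_eq_near_b hℓ hyI.1 hy] at hd
    have h4 : deriv X.ψb ((y - X.b) ^ ℓ) ≠ 0 := left_ne_zero_of_mul hd.ne'
    rw [logDistortion, X.deriv_eq_near_b hℓ hyI.1 hy, Real.log_mul h4 (by positivity),
      Real.log_mul (by positivity) h3.ne', Real.log_rpow h2]
    ring
  rcases hx.2.eq_or_lt with h2 | h2
  · subst h2
    have hψ : ContDiffAt ℝ 1 (fun y => Real.log (deriv X.ψa ((X.a + 1 - y) ^ ℓ))) (X.a + 1) := by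
      have := contDiffAt_log_deriv_rpow X.ψa_smooth X.ψa_deriv_pos hℓ
      refine ContDiffAt.comp (g := fun t : ℝ => Real.log (deriv X.ψa (t ^ ℓ)))
        (f := fun y => X.a + 1 - y) (X.a + 1) ?_ (by fun_prop)
      rwa [sub_self]
    refine ⟨fun y => Real.log (deriv X.ψa ((X.a + 1 - y) ^ ℓ)) + Real.log ℓ -
      (ℓ - 1) * Real.log (y - X.b),
      (hψ.add contDiffAt_const).sub (contDiffAt_const.mul (hlog_b _ hba.ne')), ?_⟩
    filter_upwards [Ioi_mem_nhds (show X.a + 1 - X.ε < X.a + 1 by linarith)] with y hy hyI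
    have hd := X.deriv_pos y hyI
    have h2 := sub_pos.2 hyI.2
    have h3 := Real.rpow_pos_of_pos h2 (ℓ - 1)
    rw [X.deriv_eq_near_a hℓ hy hyI.2] at hd
    have h4 : deriv X.ψa ((X.a + 1 - y) ^ ℓ) ≠ 0 := left_ne_zero_of_mul hd.ne'
    rw [logDistortion, X.deriv_eq_near_a hℓ hy hyI.2, Real.log_mul h4 (by positivity),
      Real.log_mul (by positivity) h3.ne', Real.log_rpow h2]
    ring
  · refine ⟨X.logDistortion, ?_, Eventually.of_forall fun _ _ => rfl⟩
    have hF : ContDiffAt ℝ 1 (deriv X.F) x := by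
      have := (X.contDiffAt ⟨h1, h2⟩).fderiv_right (m := 1) (by norm_num [one_add_one_eq_two])
      have h3 := this.clm_apply (contDiffAt_const (c := (1 : ℝ)))
      simpa [fderiv_apply_one_eq_deriv] using h3
    exact (hF.log (X.deriv_pos x ⟨h1, h2⟩).ne').sub
      (contDiffAt_const.mul ((hlog_b x h1.ne').add (hlog_a x h2.ne)))

theorem exists_flatCircleMap (hℓ : 1 < ℓ) :
    ∃ Y : FlatCircleMap, Y.F = X.F ∧ Y.a = X.a ∧ Y.b = X.b := by
  obtain ⟨m, hm⟩ := X.rho_lim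
  obtain ⟨h, h_mono, h_add_one, h_map⟩ := exists_monotone_semiconj X.mono X.degree_one (hm 0)
  obtain ⟨C, hC, hlip⟩ := X.exists_lipschitz_logDistortion hℓ
  exact ⟨{
    F := X.F
    h := fun x => h x - h X.a
    g := X.logDistortion
    a := X.a
    b := X.b
    ρ := X.rho + m
    r := ℓ - 1
    C := C
    mono := X.mono
    cont := X.continuous_F hℓ
    map_add_one := X.degree_one
    hab := X.hab
    hba := X.hba
    flat := X.flat
    r_pos := by linarith
    C_nonneg := hC
    lip := hlip
    hasDerivAt := fun t ht => by
      rw [X.exp_logDistortion ht]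
      exact ((X.contDiffAt ht).differentiableAt (by norm_num)).hasDerivAt
    irr := X.rho_irrational.add_intCast m
    h_mono := fun x y hxy => sub_le_sub_right (h_mono hxy) _
    h_add_one := fun x => by rw [h_add_one]; ring
    h_map := fun x => by rw [h_map]; ring
    h_a := sub_self _ }, rfl, rfl, rfl⟩

theorem isOpen_U : IsOpen X.U := QuotientAddGroup.isOpenMap_coe _ isOpen_Ioo

theorem iterate_coe (n : ℕ) (t : ℝ) :
    X.f^[n] (t : AddCircle (1 : ℝ)) = ((X.F^[n] t : ℝ) : AddCircle (1 : ℝ)) :=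
  ((Function.Semiconj.iterate_right (f := fun t : ℝ => (t : AddCircle (1 : ℝ)))
    (fun x => (X.isLift x).symm) n) t).symm

theorem coe_mem_U {y : ℝ} {i : ℤ} (h : y + i ∈ Set.Ioo X.a X.b) : (y : AddCircle (1 : ℝ)) ∈ X.U := by
  refine ⟨y + i, h, ?_⟩
  simp

end CherryMap

/-- for a Cherry map of exponent `ℓ > 1`, the union of the preimages of the
flat arc `U` has full Lebesgue (Haar) measure in `ℝ/ℤ`. -/
theorem wandering_set_full_measure (ℓ : ℝ) (hℓ : 1 < ℓ) (X : CherryMap ℓ) :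
    MeasureTheory.volume (⋃ n : ℕ, (X.f^[n]) ⁻¹' X.U)ᶜ = 0 := by
  obtain ⟨Y, hF, ha, hb⟩ := X.exists_flatCircleMap hℓ
  have hmeas : MeasurableSet (⋃ n : ℕ, (X.f^[n]) ⁻¹' X.U)ᶜ :=
    (isOpen_iUnion fun n => X.isOpen_U.preimage (X.cont.iterate n)).measurableSet.compl
  rw [← (AddCircle.measurePreserving_mk 1 0).measure_preimage hmeas.nullMeasurableSet]
  refine MeasureTheory.Measure.absolutelyContinuous_of_le MeasureTheory.Measure.restrict_le_self
    (MeasureTheory.measure_mono_null ?_ Y.volume_nonwandering_eq_zero)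
  intro t ht n i hi
  rw [hF, ha, hb] at hi
  apply ht
  rw [Set.mem_iUnion]
  refine ⟨n, ?_⟩
  change X.f^[n] (t : AddCircle (1 : ℝ)) ∈ X.U
  rw [X.iterate_coe]
  exact X.coe_mem_U hi
end

section
/- Let ℓ > 1, let C ∈ (0,1), let K > 0, let n ≥ 2 be an integer, and let a, a' be positive integers satisfying (1 − ℓ^{−a'})/((ℓ−1)·a') ≤ C and ℓ^{−a} ≤ C². Let q_{n−1}, q_n > 0 be reals and set q_{n+1} := a'·q_n + q_{n−1}. If nonnegative reals θ_{n−2}, θ_{n−1}, θ_n satisfy θ_{n−1} ≤ K·C^{n−1}·q_n, θ_{n−2} ≤ K·C^{n−2}·q_{n−1}, and θ_n ≤ ((1−ℓ^{−a'})/(ℓ−1))·θ_{n−1} + ℓ^{−a}·θ_{n−2}, then θ_n ≤ K·Cⁿ·q_{n+1}. -/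
/-- the inductive step bounding `θ_n ≤ K·Cⁿ·q_{n+1}`. -/
theorem cherry_inductive_step (ℓ C K : ℝ) (hℓ : 1 < ℓ) (hC : C ∈ Set.Ioo (0 : ℝ) 1)
    (hK : 0 < K) (n : ℕ) (hn : 2 ≤ n) (a a' : ℕ) (ha : 1 ≤ a) (ha' : 1 ≤ a')
    (hCa' : (1 - ℓ ^ (-(a' : ℝ))) / ((ℓ - 1) * a') ≤ C)
    (hCa : ℓ ^ (-(a : ℝ)) ≤ C ^ 2)
    (qnm qn : ℝ) (hqnm : 0 < qnm) (hqn : 0 < qn)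
    (θnm2 θnm1 θn : ℝ) (hθnm2 : 0 ≤ θnm2) (hθnm1 : 0 ≤ θnm1) (hθn : 0 ≤ θn)
    (hb1 : θnm1 ≤ K * C ^ (n - 1) * qn)
    (hb2 : θnm2 ≤ K * C ^ (n - 2) * qnm)
    (hrec : θn ≤ ((1 - ℓ ^ (-(a' : ℝ))) / (ℓ - 1)) * θnm1 + ℓ ^ (-(a : ℝ)) * θnm2) :
    θn ≤ K * C ^ n * (a' * qn + qnm) := by
  obtain ⟨hC0, -⟩ := hC
  obtain ⟨m, rfl⟩ := Nat.exists_eq_add_of_le' hn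
  have ha'_pos : (0 : ℝ) < a' := by exact_mod_cast ha'
  have hcoeff : (1 - ℓ ^ (-(a' : ℝ))) / (ℓ - 1) ≤ C * a' := by
    rwa [← div_div, div_le_iff₀ ha'_pos] at hCa'
  rw [show m + 2 - 1 = m + 1 by omega] at hb1
  rw [show m + 2 - 2 = m by omega] at hb2
  calc θn ≤ ((1 - ℓ ^ (-(a' : ℝ))) / (ℓ - 1)) * θnm1 + ℓ ^ (-(a : ℝ)) * θnm2 := hrec
    _ ≤ (C * a') * θnm1 + C ^ 2 * θnm2 := by gcongr
    _ ≤ (C * a') * (K * C ^ (m + 1) * qn) + C ^ 2 * (K * C ^ m * qnm) := by gcongr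
    _ = K * C ^ (m + 2) * (a' * qn + qnm) := by ring
end

section
/- Let ρ ∈ (0,1) be irrational with convergent denominators q_n, and let A ⊂ ℝ/ℤ be the open arc with endpoints 0 and q_n·ρ (mod 1) whose length is ‖q_n·ρ‖. Then the translated arcs A + j·ρ (mod 1), for j = 0, 1, …, q_{n+1} − 1, are pairwise disjoint. -/
noncomputable section

/-- The numerators of the convergents of `ρ`: `p_0 = 0`, `p_1 = 1`,
`p_{n+2} = a_{n+2} p_{n+1} + p_n`. -/
def cfP (ρ : ℝ) : ℕ → ℕ
  | 0 => 0
  | 1 => 1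
  | n + 2 => cfA ρ (n + 2) * cfP ρ (n + 1) + cfP ρ n

theorem irrational_gaussMap {x : ℝ} (hx : Irrational x) : Irrational (gaussMap x) := by
  unfold gaussMap Int.fract
  rw [one_div]
  exact hx.inv.sub_intCast _

theorem gaussMap_mem_Ioo {x : ℝ} (hx : Irrational x) : gaussMap x ∈ Set.Ioo (0 : ℝ) 1 :=
  ⟨lt_of_le_of_ne (Int.fract_nonneg _) (irrational_gaussMap hx).ne_zero.symm, Int.fract_lt_one _⟩

theorem gaussMap_iterate_mem {ρ : ℝ} (hρ : ρ ∈ Set.Ioo (0 : ℝ) 1) (hirr : Irrational ρ) (n : ℕ) :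
    gaussMap^[n] ρ ∈ Set.Ioo (0 : ℝ) 1 ∧ Irrational (gaussMap^[n] ρ) := by
  induction n with
  | zero => exact ⟨hρ, hirr⟩
  | succ n ih =>
    rw [Function.iterate_succ_apply']
    exact ⟨gaussMap_mem_Ioo ih.2, irrational_gaussMap ih.2⟩

theorem cfA_succ_eq {ρ : ℝ} (hρ : ρ ∈ Set.Ioo (0 : ℝ) 1) (hirr : Irrational ρ) (n : ℕ) :
    (cfA ρ (n + 1) : ℝ) = 1 / gaussMap^[n] ρ - gaussMap^[n + 1] ρ := by
  have hpos := (gaussMap_iterate_mem hρ hirr n).1.1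
  rw [Function.iterate_succ_apply']
  unfold cfA gaussMap Int.fract
  rw [Nat.add_sub_cancel, natCast_floor_eq_intCast_floor (by positivity)]
  ring

theorem cfQ_mul_sub_cfP_succ {ρ : ℝ} (hρ : ρ ∈ Set.Ioo (0 : ℝ) 1) (hirr : Irrational ρ) (n : ℕ) :
    (cfQ ρ (n + 1) : ℝ) * ρ - cfP ρ (n + 1) =
      -((cfQ ρ n : ℝ) * ρ - cfP ρ n) * gaussMap^[n + 1] ρ := by
  have ha := cfA_succ_eq hρ hirr n
  induction n with
  | zero =>
    have := hρ.1.ne'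
    simp only [cfQ, cfP, zero_add, Function.iterate_zero, id] at ha ⊢
    rw [ha]
    push_cast
    field_simp
    ring
  | succ n ih =>
    have hg := (gaussMap_iterate_mem hρ hirr (n + 1)).1.1.ne'
    have ih := ih (cfA_succ_eq hρ hirr n)
    have hprev : (cfQ ρ n : ℝ) * ρ - cfP ρ n =
        -((cfQ ρ (n + 1) : ℝ) * ρ - cfP ρ (n + 1)) * (1 / gaussMap^[n + 1] ρ) := by
      rw [ih]
      field_simp
    simp only [cfQ, cfP]
    push_cast
    linear_combination hprev + ((cfQ ρ (n + 1) : ℝ) * ρ - cfP ρ (n + 1)) * ha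

theorem cfQ_mul_sub_cfP_ne_zero {ρ : ℝ} (hρ : ρ ∈ Set.Ioo (0 : ℝ) 1) (hirr : Irrational ρ)
    (n : ℕ) : (cfQ ρ n : ℝ) * ρ - cfP ρ n ≠ 0 := by
  induction n with
  | zero => simpa [cfQ, cfP] using hρ.1.ne'
  | succ n ih =>
    rw [cfQ_mul_sub_cfP_succ hρ hirr]
    exact mul_ne_zero (neg_ne_zero.2 ih) (gaussMap_iterate_mem hρ hirr _).1.1.ne'

/-- Consecutive convergents lie on opposite sides of `ρ`. -/
theorem cfQ_mul_sub_cfP_mul_succ_neg {ρ : ℝ} (hρ : ρ ∈ Set.Ioo (0 : ℝ) 1) (hirr : Irrational ρ)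
    (n : ℕ) :
    ((cfQ ρ n : ℝ) * ρ - cfP ρ n) * ((cfQ ρ (n + 1) : ℝ) * ρ - cfP ρ (n + 1)) < 0 := by
  rw [cfQ_mul_sub_cfP_succ hρ hirr]
  have hsq := sq_pos_of_ne_zero (cfQ_mul_sub_cfP_ne_zero hρ hirr n)
  have := mul_pos hsq (gaussMap_iterate_mem hρ hirr (n + 1)).1.1
  linarith

theorem cfP_cfQ_determinant (ρ : ℝ) (n : ℕ) :
    (cfP ρ (n + 1) : ℤ) * cfQ ρ n - cfP ρ n * cfQ ρ (n + 1) = (-1) ^ n := by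
  induction n with
  | zero => simp [cfP, cfQ]
  | succ n ih =>
    simp only [cfP, cfQ]
    push_cast
    rw [pow_succ, ← ih]
    ring

/-- Best approximation property of the convergents. -/
theorem abs_cfQ_mul_sub_cfP_le {ρ : ℝ} (hρ : ρ ∈ Set.Ioo (0 : ℝ) 1) (hirr : Irrational ρ)
    (n : ℕ) {k m : ℤ} (hk : 0 < k) (hkq : k < cfQ ρ (n + 1)) :
    |(cfQ ρ n : ℝ) * ρ - cfP ρ n| ≤ |(k : ℝ) * ρ - m| := by
  obtain ⟨x, y, hkxy, hmxy⟩ : ∃ x y : ℤ, k = x * cfQ ρ n + y * cfQ ρ (n + 1) ∧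
      m = x * cfP ρ n + y * cfP ρ (n + 1) := by
    have hdet := cfP_cfQ_determinant ρ n
    have hsq : ((-1 : ℤ) ^ n) * (-1) ^ n = 1 := by rw [← mul_pow]; simp
    refine ⟨(-1) ^ n * (k * cfP ρ (n + 1) - m * cfQ ρ (n + 1)),
      (-1) ^ n * (m * cfQ ρ n - k * cfP ρ n), ?_, ?_⟩
    · linear_combination (-k) * hsq - k * (-1) ^ n * hdet
    · linear_combination (-m) * hsq - m * (-1) ^ n * hdet
  have hneg := cfQ_mul_sub_cfP_mul_succ_neg hρ hirr n
  have hsum : (k : ℝ) * ρ - m = x * ((cfQ ρ n : ℝ) * ρ - cfP ρ n) +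
      y * ((cfQ ρ (n + 1) : ℝ) * ρ - cfP ρ (n + 1)) := by
    rw [hkxy, hmxy]
    push_cast
    ring
  have hq : (0 : ℤ) ≤ cfQ ρ n := Int.natCast_nonneg _
  have hx : x ≠ 0 := by
    rintro rfl
    rcases le_or_gt y 0 with hy | hy <;> nlinarith
  have hxy : x * y ≤ 0 := by
    rcases lt_trichotomy y 0 with hy | rfl | hy
    · have : 0 < x * cfQ ρ n := by nlinarith
      nlinarith [pos_of_mul_pos_left this hq]
    · simp
    · have : x * cfQ ρ n < 0 := by nlinarith
      nlinarith [neg_of_mul_neg_left this hq]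
  have hxyR : (x : ℝ) * y ≤ 0 := by exact_mod_cast hxy
  have hx1 : (1 : ℝ) ≤ (x : ℝ) ^ 2 := by
    have : 1 ≤ x ^ 2 := Int.add_one_le_iff.2 (sq_pos_of_ne_zero hx)
    exact_mod_cast this
  rw [← sq_le_sq, hsum]
  generalize (cfQ ρ n : ℝ) * ρ - cfP ρ n = a at *
  generalize (cfQ ρ (n + 1) : ℝ) * ρ - cfP ρ (n + 1) = b at *
  nlinarith [mul_nonneg_of_nonpos_of_nonpos hxyR hneg.le,
    mul_nonneg (sub_nonneg.2 hx1) (sq_nonneg a), sq_nonneg ((y : ℝ) * b)]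

/-- let `A ⊂ ℝ/ℤ` be the open arc with endpoints `0` and `q_n·ρ (mod 1)`
whose length is `‖q_n·ρ‖` (the distance from `q_n·ρ` to the nearest integer). Then the
translates `A + j·ρ`, `j = 0, 1, …, q_{n+1} − 1`, are pairwise disjoint. -/
theorem arc_translates_disjoint (ρ : ℝ) (hρ : ρ ∈ Set.Ioo (0 : ℝ) 1)
    (hirr : Irrational ρ) (n : ℕ)
    (δ : ℝ) (hδ : δ = (cfQ ρ n : ℝ) * ρ - round ((cfQ ρ n : ℝ) * ρ))
    (A : Set (AddCircle (1 : ℝ)))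
    (hA : A = (fun t : ℝ => (t : AddCircle (1 : ℝ))) '' Set.Ioo (min 0 δ) (max 0 δ)) :
    ∀ i < cfQ ρ (n + 1), ∀ j < cfQ ρ (n + 1), i ≠ j →
      Disjoint ((fun x : AddCircle (1 : ℝ) => x + (((i : ℝ) * ρ : ℝ) : AddCircle (1 : ℝ))) '' A)
        ((fun x : AddCircle (1 : ℝ) => x + (((j : ℝ) * ρ : ℝ) : AddCircle (1 : ℝ))) '' A) := by
  have key : ∀ i < cfQ ρ (n + 1), ∀ j < i,
      Disjoint ((fun x : AddCircle (1 : ℝ) => x + (((i : ℝ) * ρ : ℝ) : AddCircle (1 : ℝ))) '' A)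
        ((fun x : AddCircle (1 : ℝ) => x + (((j : ℝ) * ρ : ℝ) : AddCircle (1 : ℝ))) '' A) := by
    intro i hi j hji
    rw [Set.disjoint_left, hA]
    rintro _ ⟨_, ⟨s, hs, rfl⟩, rfl⟩ ⟨_, ⟨t, ht, rfl⟩, hst⟩
    have hst : ((t + j * ρ : ℝ) : AddCircle (1 : ℝ)) = ((s + i * ρ : ℝ) : AddCircle (1 : ℝ)) := by
      simpa only [AddCircle.coe_add] using hst
    obtain ⟨m, hm⟩ := (AddCircle.coe_eq_zero_iff (1 : ℝ)).1
      ((AddCircle.coe_sub (1 : ℝ) _ _).trans (sub_eq_zero.2 hst.symm))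
    have hbest := abs_cfQ_mul_sub_cfP_le hρ hirr n (k := (i : ℤ) - j) (m := m)
      (by omega) (by omega)
    have hround : |δ| ≤ |(cfQ ρ n : ℝ) * ρ - cfP ρ n| := by
      rw [hδ]
      exact_mod_cast round_le ((cfQ ρ n : ℝ) * ρ) (cfP ρ n : ℤ)
    have hlt : |t - s| < |δ| := by
      rw [show |δ| = max 0 δ - min 0 δ by rw [max_sub_min_eq_abs, sub_zero], abs_lt]
      constructor <;> linarith [hs.1, hs.2, ht.1, ht.2]
    have hdiff : (((i : ℤ) - j : ℤ) : ℝ) * ρ - m = t - s := by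
      rw [zsmul_one] at hm
      push_cast
      linarith
    rw [hdiff] at hbest
    linarith
  intro i hi j hj hij
  rcases lt_or_gt_of_ne hij with h | h
  · exact (key j hj i h).symm
  · exact key i hi j h

end
end
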